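/- Under the two-group random mixture model, for every FDR level α∈[0,1] the limit FNR*(α) := lim_{n→∞} FNR*_n(α) exists and, as a function of α on [0,1], FNR* equals the greatest convex minorant of mFNR*, i.e. FNR*(α) = sup{C(α) : C convex on [0,1] with C(t)≤mFNR*(t) for all t∈[0,1]}. -/

import Mathlib

open MeasureTheory ProbabilityTheory Filter

namespace TwoGroup

/-- The two-group random mixture model: a σ-finite base measure on the sample space `𝒳`,
a null proportion `π0 ∈ (0,1)`, and null/non-null probability density functions `f0`, `f1`
with respect to the base measure. -/
structure Model (𝒳 : Type*) [MeasurableSpace 𝒳] where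
  base : Measure 𝒳
  sigmaFinite : SigmaFinite base
  π0 : ℝ
  π0_mem : π0 ∈ Set.Ioo (0 : ℝ) 1
  f0 : 𝒳 → ℝ
  f1 : 𝒳 → ℝ
  f0_meas : Measurable f0
  f1_meas : Measurable f1
  f0_nonneg : ∀ x, 0 ≤ f0 x
  f1_nonneg : ∀ x, 0 ≤ f1 x
  f0_prob : IsProbabilityMeasure (base.withDensity fun x => ENNReal.ofReal (f0 x))
  f1_prob : IsProbabilityMeasure (base.withDensity fun x => ENNReal.ofReal (f1 x))

namespace Model

variable {𝒳 : Type*} [MeasurableSpace 𝒳] (M : Model 𝒳)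

/-- The non-null proportion `π1 = 1 - π0`. -/
noncomputable def π1 : ℝ := 1 - M.π0

/-- The marginal density `f = π0 f0 + π1 f1`. -/
noncomputable def f (x : 𝒳) : ℝ := M.π0 * M.f0 x + M.π1 * M.f1 x

/-- The local false discovery rate `Lfdr(x) = π0 f0(x) / f(x)`. -/
noncomputable def Lfdr (x : 𝒳) : ℝ := M.π0 * M.f0 x / M.f x

/-- The joint law of a single pair `(θ, X)`; `true` encodes `θ = 1` (non-null). -/
noncomputable def joint : Measure (Bool × 𝒳) :=
  (ENNReal.ofReal M.π0) •
      ((Measure.dirac false).prod (M.base.withDensity fun x => ENNReal.ofReal (M.f0 x))) +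
    (ENNReal.ofReal M.π1) •
      ((Measure.dirac true).prod (M.base.withDensity fun x => ENNReal.ofReal (M.f1 x)))

/-- The joint law of `((θ1, X1), …, (θn, Xn))`: i.i.d. copies of `(θ, X)`. -/
noncomputable def jointN (n : ℕ) : Measure (Fin n → Bool × 𝒳) :=
  Measure.pi fun _ => M.joint

end Model

/-- Number of rejections `Σ_i δ_i`. -/
def nRej {n : ℕ} (d : Fin n → Bool) : ℝ := ∑ i, if d i then (1 : ℝ) else 0

/-- Number of false discoveries `Σ_i δ_i (1 - θ_i)`. -/
def nFD {n : ℕ} (θ d : Fin n → Bool) : ℝ :=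
  ∑ i, (if d i then (1 : ℝ) else 0) * (if θ i then (0 : ℝ) else 1)

/-- Number of acceptances `Σ_i (1 - δ_i)`. -/
def nAcc {n : ℕ} (d : Fin n → Bool) : ℝ := ∑ i, if d i then (0 : ℝ) else 1

/-- Number of false non-discoveries `Σ_i (1 - δ_i) θ_i`. -/
def nFN {n : ℕ} (θ d : Fin n → Bool) : ℝ :=
  ∑ i, (if d i then (0 : ℝ) else 1) * (if θ i then (1 : ℝ) else 0)

/-- False discovery proportion. -/
noncomputable def FDP {n : ℕ} (θ d : Fin n → Bool) : ℝ := nFD θ d / max 1 (nRej d)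

/-- False non-discovery proportion. -/
noncomputable def FNP {n : ℕ} (θ d : Fin n → Bool) : ℝ := nFN θ d / max 1 (nAcc d)

/-- A decision rule is a Markov kernel from `𝒳^n` to `{0,1}^n`: a measurable family of
probability measures on `Fin n → Bool`. -/
def IsRule {𝒳 : Type*} [MeasurableSpace 𝒳] {n : ℕ}
    (κ : (Fin n → 𝒳) → Measure (Fin n → Bool)) : Prop :=
  Measurable κ ∧ ∀ x, IsProbabilityMeasure (κ x)

namespace Model

variable {𝒳 : Type*} [MeasurableSpace 𝒳] (M : Model 𝒳)

/-- The false discovery rate `FDR = E[FDP]` of a (randomized) decision rule. -/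
noncomputable def FDR (n : ℕ) (κ : (Fin n → 𝒳) → Measure (Fin n → Bool)) : ℝ :=
  ∫ ω, ∫ d, FDP (fun i => (ω i).1) d ∂(κ fun i => (ω i).2) ∂(M.jointN n)

/-- The false non-discovery rate `FNR = E[FNP]` of a (randomized) decision rule. -/
noncomputable def FNR (n : ℕ) (κ : (Fin n → 𝒳) → Measure (Fin n → Bool)) : ℝ :=
  ∫ ω, ∫ d, FNP (fun i => (ω i).1) d ∂(κ fun i => (ω i).2) ∂(M.jointN n)

/-- The marginal FDR `mFDR = E[Σ δi (1-θi)] / E[Σ δi]` (with `0/0 = 0`). -/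
noncomputable def mFDR (n : ℕ) (κ : (Fin n → 𝒳) → Measure (Fin n → Bool)) : ℝ :=
  (∫ ω, ∫ d, nFD (fun i => (ω i).1) d ∂(κ fun i => (ω i).2) ∂(M.jointN n)) /
    (∫ ω, ∫ d, nRej d ∂(κ fun i => (ω i).2) ∂(M.jointN n))

/-- The marginal FNR `mFNR = E[Σ (1-δi) θi] / E[Σ (1-δi)]` (with `0/0 = 0`). -/
noncomputable def mFNR (n : ℕ) (κ : (Fin n → 𝒳) → Measure (Fin n → Bool)) : ℝ :=
  (∫ ω, ∫ d, nFN (fun i => (ω i).1) d ∂(κ fun i => (ω i).2) ∂(M.jointN n)) /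
    (∫ ω, ∫ d, nAcc d ∂(κ fun i => (ω i).2) ∂(M.jointN n))

/-- `FNR*_n(α)`: the minimum FNR over decision rules controlling FDR at level `α`. -/
noncomputable def FNRstar (n : ℕ) (α : ℝ) : ℝ :=
  sInf {r | ∃ κ : (Fin n → 𝒳) → Measure (Fin n → Bool),
    IsRule κ ∧ M.FDR n κ ≤ α ∧ r = M.FNR n κ}

/-- The minimum mFNR over decision rules for `n` hypotheses controlling mFDR at level `α`. -/
noncomputable def mFNRstarN (n : ℕ) (α : ℝ) : ℝ :=
  sInf {r | ∃ κ : (Fin n → 𝒳) → Measure (Fin n → Bool),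
    IsRule κ ∧ M.mFDR n κ ≤ α ∧ r = M.mFNR n κ}

/-- `mFNR*(α)` (this quantity does not depend on the number of hypotheses; we take `n = 1`). -/
noncomputable def mFNRstar (α : ℝ) : ℝ := M.mFNRstarN 1 α

/-- The marginal law of a single observation `X ∼ f`. -/
noncomputable def Pmix : Measure 𝒳 := M.base.withDensity fun x => ENNReal.ofReal (M.f x)

/-- The law of `W = Lfdr(X)`, `X ∼ f`. -/
noncomputable def νW : Measure ℝ := M.Pmix.map M.Lfdr

/-- `G(t) = P(W ≤ t)`. -/
noncomputable def G (t : ℝ) : ℝ := (M.νW (Set.Iic t)).toReal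

/-- `Ḡ(t) = P(W < t)`. -/
noncomputable def Gbar (t : ℝ) : ℝ := (M.νW (Set.Iio t)).toReal

/-- The generalized inverse `G^{-1}(u) = inf{t : G(t) ≥ u}`. -/
noncomputable def Ginv (u : ℝ) : ℝ := sInf {t | u ≤ M.G t}

/-- `P(W = t)`. -/
noncomputable def atom (t : ℝ) : ℝ := (M.νW {t}).toReal

/-- The randomization probability `p(u)`, satisfying
`Ḡ(G^{-1}(u)) + p(u) P(W = G^{-1}(u)) = u`. -/
noncomputable def pu (u : ℝ) : ℝ := (u - M.Gbar (M.Ginv u)) / M.atom (M.Ginv u)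

/-- `a(u) = E[W | S_u = 1]` for `u ∈ (0,1]`, `a(0) = 0`, where `S_u` is the Bernoulli(u)
thresholding variable of `W` at `G^{-1}(u)` with randomization `p(u)` at the boundary. -/
noncomputable def a (u : ℝ) : ℝ :=
  if u = 0 then 0
  else ((∫ w in Set.Iio (M.Ginv u), w ∂M.νW) + M.pu u * (M.Ginv u * M.atom (M.Ginv u))) / u

/-- `b(u) = E[1 - W | S_u = 0]` for `u ∈ [0,1)`, `b(1) = 0`. -/
noncomputable def b (u : ℝ) : ℝ :=
  if u = 1 then 0
  else ((∫ w in Set.Ioi (M.Ginv u), (1 - w) ∂M.νW)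
      + (1 - M.pu u) * ((1 - M.Ginv u) * M.atom (M.Ginv u))) / (1 - u)

/-- `b*(α) = inf{b(u) : u ∈ [0,1], a(u) ≤ α}`. -/
noncomputable def bstar (α : ℝ) : ℝ :=
  sInf {y | ∃ u ∈ Set.Icc (0 : ℝ) 1, M.a u ≤ α ∧ y = M.b u}

/-- `u*(α) = sup{u ∈ [0,1] : a(u) ≤ α}`. -/
noncomputable def ustar (α : ℝ) : ℝ :=
  sSup {u | u ∈ Set.Icc (0 : ℝ) 1 ∧ M.a u ≤ α}

/-- `b**(α) = inf{E[b(U)] : U a [0,1]-valued random variable with E[a(U)] ≤ α}`. -/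
noncomputable def bstarstar (α : ℝ) : ℝ :=
  sInf {y | ∃ ρ : Measure ℝ, IsProbabilityMeasure ρ ∧ (∀ᵐ u ∂ρ, u ∈ Set.Icc (0 : ℝ) 1) ∧
    (∫ u, M.a u ∂ρ) ≤ α ∧ y = ∫ u, M.b u ∂ρ}

end Model

/-- The Bernoulli(p) measure on `Bool`. -/
noncomputable def bern (p : ℝ) : Measure Bool :=
  (ENNReal.ofReal p) • Measure.dirac true + (ENNReal.ofReal (1 - p)) • Measure.dirac false

namespace Model

variable {𝒳 : Type*} [MeasurableSpace 𝒳] (M : Model 𝒳)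

/-- The per-observation rejection probability of the Neyman–Pearson rule at level `α`:
reject if `Lfdr(x) < G^{-1}(u*(α))`, randomize with probability `p(u*(α))` at equality,
and accept otherwise. -/
noncomputable def qNP (α : ℝ) (x : 𝒳) : ℝ :=
  if M.Lfdr x < M.Ginv (M.ustar α) then 1
  else if M.Lfdr x = M.Ginv (M.ustar α) then M.pu (M.ustar α)
  else 0

/-- The Neyman–Pearson rule `δ^n_NP(α)`, as a Markov kernel: independent randomized
likelihood-ratio tests applied to each observation. -/
noncomputable def NP (α : ℝ) (n : ℕ) : (Fin n → 𝒳) → Measure (Fin n → Bool) :=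
  fun x => Measure.pi fun i => bern (M.qNP α (x i))

/-- The probability (over data and the randomization of the rule `κ`) that the decision vector
lies in the set `E θ` (which may depend on the true labels `θ`). -/
noncomputable def prob (n : ℕ) (κ : (Fin n → 𝒳) → Measure (Fin n → Bool))
    (E : (Fin n → Bool) → Set (Fin n → Bool)) : ℝ :=
  (∫⁻ ω, κ (fun i => (ω i).2) (E fun i => (ω i).1) ∂(M.jointN n)).toReal

end Model

/-- `sortedVal n w i` is the `i`-th order statistic `w_(i)` (for `1 ≤ i ≤ n`) of
`w 0, …, w (n-1)`. -/
noncomputable def sortedVal (n : ℕ) (w : Fin n → ℝ) (i : ℕ) : ℝ :=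
  ((Multiset.map w Finset.univ.val).sort (· ≤ ·)).getD (i - 1) 0

/-- `avgLow n w k = (1/k) Σ_{i=1}^k w_(i)` (equal to `0` when `k = 0`). -/
noncomputable def avgLow (n : ℕ) (w : Fin n → ℝ) (k : ℕ) : ℝ :=
  (∑ i ∈ Finset.Icc 1 k, sortedVal n w i) / k

/-- `avgHigh n w k = (1/(n-k)) Σ_{i=k+1}^n (1 - w_(i))` (equal to `0` when `k = n`). -/
noncomputable def avgHigh (n : ℕ) (w : Fin n → ℝ) (k : ℕ) : ℝ :=
  (∑ i ∈ Finset.Icc (k + 1) n, (1 - sortedVal n w i)) / ((n : ℝ) - k)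

/-- The greatest convex minorant on `[0,1]` of a function `h`, evaluated at `α`. -/
noncomputable def gcm (h : ℝ → ℝ) (α : ℝ) : ℝ :=
  sSup {y | ∃ C : ℝ → ℝ, ConvexOn ℝ (Set.Icc 0 1) C ∧
    (∀ t ∈ Set.Icc (0 : ℝ) 1, C t ≤ h t) ∧ y = C α}

end TwoGroup

namespace TwoGroup

section Posterior

variable {𝒳 : Type*} [MeasurableSpace 𝒳]

/-- `W b x` is the conditional probability, given the observation `x`, that the label differs
from the decision `b`, under the joint law `P` of a label and an observation. -/
structure IsPosterior (P : Measure (Bool × 𝒳)) (W : Bool → 𝒳 → ℝ) : Prop where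
  meas : ∀ b, Measurable (W b)
  nonneg : ∀ b x, 0 ≤ W b x
  sum_one : ∀ b x, W b x + W (!b) x = 1
  integral_eq : ∀ b (g : 𝒳 → ℝ), Measurable g → (∀ x, |g x| ≤ 1) →
    ∫ z, (if z.1 = b then 0 else 1) * g z.2 ∂P = ∫ z, W b z.2 * g z.2 ∂P

theorem IsPosterior.le_one {P : Measure (Bool × 𝒳)} {W : Bool → 𝒳 → ℝ} (hW : IsPosterior P W)
    (b : Bool) (x : 𝒳) : W b x ≤ 1 := by
  linarith [hW.sum_one b x, hW.nonneg (!b) x]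

theorem integrable_of_bound {Ω : Type*} [MeasurableSpace Ω] {μ : Measure Ω} [IsFiniteMeasure μ]
    {g : Ω → ℝ} (hg : Measurable g) (C : ℝ) (hC : ∀ x, |g x| ≤ C) : Integrable g μ :=
  Integrable.of_bound hg.aestronglyMeasurable C (ae_of_all _ hC)

namespace Model

variable (M : Model 𝒳)

theorem π1_pos : 0 < M.π1 := by
  have := M.π0_mem.2
  unfold π1
  linarith

theorem isProbabilityMeasure_joint : IsProbabilityMeasure M.joint := by
  have := M.f0_prob
  have := M.f1_prob
  constructor
  simp only [joint, Measure.add_apply, Measure.smul_apply, smul_eq_mul, measure_univ, mul_one]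
  rw [← ENNReal.ofReal_add M.π0_mem.1.le M.π1_pos.le]
  simp [π1]

theorem integral_joint {F : Bool × 𝒳 → ℝ} (hF : Measurable F) (C : ℝ) (hC : ∀ z, |F z| ≤ C) :
    ∫ z, F z ∂M.joint =
      (∫ x, M.π0 * M.f0 x * F (false, x) ∂M.base) + ∫ x, M.π1 * M.f1 x * F (true, x) ∂M.base := by
  have := M.f0_prob
  have := M.f1_prob
  have := M.sigmaFinite
  have key : ∀ (b : Bool) (p : ℝ) (g : 𝒳 → ℝ), 0 ≤ p → Measurable g → (∀ x, 0 ≤ g x) →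
      ∫ z, F z ∂(ENNReal.ofReal p • ((Measure.dirac b).prod
        (M.base.withDensity fun x => ENNReal.ofReal (g x)))) =
        ∫ x, p * g x * F (b, x) ∂M.base := by
    intro b p g hp hg hg0
    rw [integral_smul_measure, Measure.dirac_prod,
      integral_map measurable_prodMk_left.aemeasurable hF.aestronglyMeasurable,
      integral_withDensity_eq_integral_toReal_smul hg.ennreal_ofReal (by simp),
      ENNReal.toReal_ofReal hp, smul_eq_mul, ← integral_const_mul]
    refine integral_congr_ae (ae_of_all _ fun x => ?_)
    simp only [ENNReal.toReal_ofReal (hg0 x), smul_eq_mul]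
    ring
  rw [joint, integral_add_measure, key _ _ _ M.π0_mem.1.le M.f0_meas M.f0_nonneg,
    key _ _ _ M.π1_pos.le M.f1_meas M.f1_nonneg]
  · exact (integrable_of_bound hF C hC).smul_measure (by simp)
  · exact (integrable_of_bound hF C hC).smul_measure (by simp)

/-- The posterior probability that the label differs from the decision `b`. -/
noncomputable def post (b : Bool) (x : 𝒳) : ℝ := if b then M.Lfdr x else 1 - M.Lfdr x

theorem f_nonneg (x : 𝒳) : 0 ≤ M.f x :=
  add_nonneg (mul_nonneg M.π0_mem.1.le (M.f0_nonneg x)) (mul_nonneg M.π1_pos.le (M.f1_nonneg x))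

theorem Lfdr_nonneg (x : 𝒳) : 0 ≤ M.Lfdr x :=
  div_nonneg (mul_nonneg M.π0_mem.1.le (M.f0_nonneg x)) (M.f_nonneg x)

theorem Lfdr_le_one (x : 𝒳) : M.Lfdr x ≤ 1 := by
  refine div_le_one_of_le₀ ?_ (M.f_nonneg x)
  simpa [f] using mul_nonneg M.π1_pos.le (M.f1_nonneg x)

theorem measurable_Lfdr : Measurable M.Lfdr := by
  unfold Lfdr f
  exact (M.f0_meas.const_mul _).div ((M.f0_meas.const_mul _).add (M.f1_meas.const_mul _))

theorem measurable_post (b : Bool) : Measurable (M.post b) := by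
  cases b
  · exact M.measurable_Lfdr.const_sub 1
  · exact M.measurable_Lfdr

theorem Lfdr_mul_f (x : 𝒳) : M.Lfdr x * (M.π0 * M.f0 x + M.π1 * M.f1 x) = M.π0 * M.f0 x := by
  have h0 := mul_nonneg M.π0_mem.1.le (M.f0_nonneg x)
  have h1 := mul_nonneg M.π1_pos.le (M.f1_nonneg x)
  by_cases hf : M.f x = 0
  · have : M.π0 * M.f0 x = 0 := by unfold f at hf; linarith
    simp [Lfdr, this]
  · exact div_mul_cancel₀ _ hf

theorem integrable_density :
    Integrable (fun x => M.π0 * M.f0 x) M.base ∧ Integrable (fun x => M.π1 * M.f1 x) M.base := by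
  have key : ∀ g : 𝒳 → ℝ, Measurable g → (∀ x, 0 ≤ g x) →
      IsProbabilityMeasure (M.base.withDensity fun x => ENNReal.ofReal (g x)) →
      Integrable g M.base := by
    intro g hg hg0 h
    refine ⟨hg.aestronglyMeasurable, ?_⟩
    rw [hasFiniteIntegral_iff_ofReal (ae_of_all _ hg0)]
    have := measure_univ (μ := M.base.withDensity fun x => ENNReal.ofReal (g x))
    rw [withDensity_apply _ MeasurableSet.univ, Measure.restrict_univ] at this
    simp [this]
  exact ⟨(key _ M.f0_meas M.f0_nonneg M.f0_prob).const_mul _,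
    (key _ M.f1_meas M.f1_nonneg M.f1_prob).const_mul _⟩

theorem isPosterior_post : IsPosterior M.joint M.post where
  meas := M.measurable_post
  nonneg b x := by
    cases b
    · simpa [post] using M.Lfdr_le_one x
    · simpa [post] using M.Lfdr_nonneg x
  sum_one b x := by cases b <;> simp [post]
  integral_eq b g hg hg1 := by
    have hL0 := M.Lfdr_nonneg
    have hL1 := M.Lfdr_le_one
    have hp1 : ∀ x, |M.post b x| ≤ 1 := by
      intro x
      rw [abs_le]
      cases b <;> simp only [post] <;> constructor <;> simp <;> linarith [hL0 x, hL1 x]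
    have hm : Measurable fun z : Bool × 𝒳 => (if z.1 = b then (0 : ℝ) else 1) * g z.2 :=
      ((measurable_of_countable fun t : Bool => if t = b then (0 : ℝ) else 1).comp
        measurable_fst).mul (hg.comp measurable_snd)
    have hbd : ∀ h : 𝒳 → ℝ, Measurable h → (∀ x, |h x| ≤ 1) →
        Integrable (fun x => M.π0 * M.f0 x * h x) M.base ∧
        Integrable (fun x => M.π1 * M.f1 x * h x) M.base := fun h hh hh1 =>
      ⟨M.integrable_density.1.mul_bdd (c := 1) hh.aestronglyMeasurable (ae_of_all _ hh1),
        M.integrable_density.2.mul_bdd (c := 1) hh.aestronglyMeasurable (ae_of_all _ hh1)⟩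
    have hpg : Measurable fun x => M.post b x * g x := (M.measurable_post b).mul hg
    have hpg1 : ∀ x, |M.post b x * g x| ≤ 1 := fun x => by
      rw [abs_mul]
      exact mul_le_one₀ (hp1 x) (abs_nonneg _) (hg1 x)
    rw [M.integral_joint hm 1, M.integral_joint
      (F := fun z => M.post b z.2 * g z.2) (hpg.comp measurable_snd) 1
        fun z => hpg1 z.2,
      ← integral_add (hbd _ hpg hpg1).1 (hbd _ hpg hpg1).2]
    · have hx := fun x => M.Lfdr_mul_f x
      cases b
      · simp only [Bool.false_eq_true, if_true, zero_mul, mul_zero, integral_zero, if_false,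
          one_mul, zero_add, Bool.true_eq_false, post]
        refine integral_congr_ae (ae_of_all _ fun x => ?_)
        linear_combination g x * hx x
      · simp only [Bool.false_eq_true, if_true, zero_mul, mul_zero, integral_zero, if_false,
          one_mul, add_zero, post]
        refine integral_congr_ae (ae_of_all _ fun x => ?_)
        linear_combination -g x * hx x
    · intro z
      rw [abs_mul]
      refine mul_le_one₀ ?_ (abs_nonneg _) (hg1 _)
      split_ifs <;> simp

end Model

end Posterior

section Rules

variable {𝒳 : Type*} [MeasurableSpace 𝒳]

/-- Number of decisions equal to `b`. -/
def cnt {n : ℕ} (b : Bool) (d : Fin n → Bool) : ℝ := ∑ i, if d i = b then (1 : ℝ) else 0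

/-- The weight of coordinate `i` in the average over the coordinates with decision `b`. -/
noncomputable def weight {n : ℕ} (b : Bool) (d : Fin n → Bool) (i : Fin n) : ℝ :=
  (if d i = b then (1 : ℝ) else 0) / max 1 (cnt b d)

/-- The loss of decision `b` at label `t`. -/
def loss (b t : Bool) : ℝ := if t = b then 0 else 1

/-- Expected proportion of errors among the coordinates with decision `b`. -/
noncomputable def risk {n : ℕ} (P : Measure (Bool × 𝒳)) (b : Bool)
    (κ : (Fin n → 𝒳) → Measure (Fin n → Bool)) : ℝ :=
  ∫ ω, ∫ d, ∑ i, loss b (ω i).1 * weight b d i ∂(κ fun i => (ω i).2) ∂(Measure.pi fun _ => P)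

/-- A randomized test of a single hypothesis: `q b x` is the probability of the decision `b`. -/
structure IsTest (q : Bool → 𝒳 → ℝ) : Prop where
  meas : ∀ b, Measurable (q b)
  nonneg : ∀ b x, 0 ≤ q b x
  sum_one : ∀ b x, q b x + q (!b) x = 1

/-- Marginal error rate of a test among the decisions equal to `b`. -/
noncomputable def rate (P : Measure (Bool × 𝒳)) (b : Bool) (q : Bool → 𝒳 → ℝ) : ℝ :=
  (∫ z, loss b z.1 * q b z.2 ∂P) / ∫ z, q b z.2 ∂P

theorem IsTest.le_one {q : Bool → 𝒳 → ℝ} (hq : IsTest q) (b : Bool) (x : 𝒳) : q b x ≤ 1 := by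
  linarith [hq.sum_one b x, hq.nonneg (!b) x]

theorem IsTest.abs_le_one {q : Bool → 𝒳 → ℝ} (hq : IsTest q) (b : Bool) (x : 𝒳) :
    |q b x| ≤ 1 := by
  rw [abs_of_nonneg (hq.nonneg b x)]
  exact hq.le_one b x

theorem loss_nonneg (b t : Bool) : 0 ≤ loss b t := by unfold loss; split_ifs <;> simp

theorem loss_le_one (b t : Bool) : loss b t ≤ 1 := by unfold loss; split_ifs <;> simp

theorem abs_loss_le_one (b t : Bool) : |loss b t| ≤ 1 := by unfold loss; split_ifs <;> simp

theorem measurable_loss (b : Bool) : Measurable (loss b) := measurable_of_countable _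

theorem cnt_nonneg {n : ℕ} (b : Bool) (d : Fin n → Bool) : 0 ≤ cnt b d :=
  Finset.sum_nonneg fun i _ => by split_ifs <;> simp

theorem max_one_cnt_pos {n : ℕ} (b : Bool) (d : Fin n → Bool) : 0 < max 1 (cnt b d) :=
  lt_max_of_lt_left one_pos

theorem weight_nonneg {n : ℕ} (b : Bool) (d : Fin n → Bool) (i : Fin n) : 0 ≤ weight b d i :=
  div_nonneg (by split_ifs <;> simp) (max_one_cnt_pos b d).le

theorem sum_weight_le_one {n : ℕ} (b : Bool) (d : Fin n → Bool) : ∑ i, weight b d i ≤ 1 := by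
  unfold weight
  rw [← Finset.sum_div]
  exact div_le_one_of_le₀ (le_max_right _ _) (max_one_cnt_pos b d).le

theorem weight_le_one {n : ℕ} (b : Bool) (d : Fin n → Bool) (i : Fin n) : weight b d i ≤ 1 :=
  (Finset.single_le_sum (fun j _ => weight_nonneg b d j) (Finset.mem_univ i)).trans
    (sum_weight_le_one b d)

theorem Model.FDR_eq_risk (M : Model 𝒳) {n : ℕ} (κ : (Fin n → 𝒳) → Measure (Fin n → Bool)) :
    M.FDR n κ = risk M.joint true κ := by
  unfold Model.FDR risk Model.jointN
  congr! with ω d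
  simp only [FDP, nFD, nRej, weight, cnt, loss, Finset.sum_div]
  exact Finset.sum_congr rfl fun i _ => by ring

theorem Model.FNR_eq_risk (M : Model 𝒳) {n : ℕ} (κ : (Fin n → 𝒳) → Measure (Fin n → Bool)) :
    M.FNR n κ = risk M.joint false κ := by
  unfold Model.FNR risk Model.jointN
  congr! with ω d
  have h : nAcc d = cnt false d := Finset.sum_congr rfl fun i _ => by cases d i <;> simp
  simp only [FNP, nFN, h, weight, loss, Finset.sum_div]
  refine Finset.sum_congr rfl fun i _ => ?_
  cases d i <;> by_cases hθ : (ω i).1 = true <;> simp [hθ]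

theorem IsRule.integral_eq {n : ℕ} {κ : (Fin n → 𝒳) → Measure (Fin n → Bool)} (hκ : IsRule κ)
    (F : (Fin n → Bool) → ℝ) (x : Fin n → 𝒳) :
    ∫ d, F d ∂κ x = ∑ d, (κ x).real {d} * F d := by
  have := hκ.2 x
  rw [integral_fintype (Integrable.of_finite)]
  simp

theorem IsRule.measurable_real {n : ℕ} {κ : (Fin n → 𝒳) → Measure (Fin n → Bool)}
    (hκ : IsRule κ) (d : Fin n → Bool) : Measurable fun x => (κ x).real {d} :=
  ((Measure.measurable_coe (MeasurableSet.singleton d)).comp hκ.1).ennreal_toReal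

theorem IsRule.real_le_one {n : ℕ} {κ : (Fin n → 𝒳) → Measure (Fin n → Bool)}
    (hκ : IsRule κ) (x : Fin n → 𝒳) (d : Fin n → Bool) : (κ x).real {d} ≤ 1 := by
  have := hκ.2 x
  exact measureReal_le_one

theorem measurable_snd_pi {n : ℕ} :
    Measurable fun (ω : Fin n → Bool × 𝒳) (i : Fin n) => (ω i).2 :=
  measurable_pi_lambda _ fun i => measurable_snd.comp (measurable_pi_apply i)

theorem IsRule.integral_weighted {n : ℕ} {κ : (Fin n → 𝒳) → Measure (Fin n → Bool)}
    (hκ : IsRule κ) (P : Measure (Bool × 𝒳)) [IsProbabilityMeasure P] (b : Bool)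
    {φ : Bool × 𝒳 → ℝ} (hφ : Measurable φ) (hφ1 : ∀ z, |φ z| ≤ 1) :
    ∫ ω, ∫ d, ∑ i, φ (ω i) * weight b d i ∂(κ fun i => (ω i).2) ∂(Measure.pi fun _ => P) =
      ∑ d, ∑ i, weight b d i *
        ∫ ω, φ (ω i) * (κ fun j => (ω j).2).real {d} ∂(Measure.pi fun _ : Fin n => P) := by
  have h_int : ∀ d (i : Fin n), Integrable
      (fun ω : Fin n → Bool × 𝒳 => weight b d i * (φ (ω i) * (κ fun j => (ω j).2).real {d}))
      (Measure.pi fun _ => P) := by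
    intro d i
    refine Integrable.const_mul (integrable_of_bound ((hφ.comp (measurable_pi_apply i)).mul
      ((hκ.measurable_real d).comp measurable_snd_pi)) 1 fun ω => ?_) _
    simp only [Pi.mul_apply, Function.comp_apply, abs_mul]
    refine mul_le_one₀ (hφ1 _) (abs_nonneg _) ?_
    rw [abs_of_nonneg measureReal_nonneg]
    exact hκ.real_le_one _ _
  simp_rw [hκ.integral_eq, Finset.mul_sum]
  have hrw : ∀ (ω : Fin n → Bool × 𝒳) (d : Fin n → Bool) (i : Fin n),
      (κ fun i => (ω i).2).real {d} * (φ (ω i) * weight b d i) =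
        weight b d i * (φ (ω i) * (κ fun j => (ω j).2).real {d}) := fun ω d i => by ring
  simp_rw [hrw]
  rw [integral_finsetSum _ fun d _ => integrable_finsetSum _ fun i _ => h_int d i]
  refine Finset.sum_congr rfl fun d _ => ?_
  rw [integral_finsetSum _ fun i _ => h_int d i]
  exact Finset.sum_congr rfl fun i _ => integral_const_mul _ _

theorem IsRule.risk_eq {n : ℕ} {κ : (Fin n → 𝒳) → Measure (Fin n → Bool)}
    (hκ : IsRule κ) (P : Measure (Bool × 𝒳)) [IsProbabilityMeasure P] (b : Bool) :
    risk P b κ = ∑ d, ∑ i, weight b d i *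
      ∫ ω, loss b (ω i).1 * (κ fun j => (ω j).2).real {d} ∂(Measure.pi fun _ : Fin n => P) :=
  hκ.integral_weighted P b (φ := fun z => loss b z.1) ((measurable_loss b).comp measurable_fst)
    fun _ => abs_loss_le_one _ _

theorem risk_nonneg {n : ℕ} (P : Measure (Bool × 𝒳)) (b : Bool)
    (κ : (Fin n → 𝒳) → Measure (Fin n → Bool)) : 0 ≤ risk P b κ :=
  integral_nonneg fun _ => integral_nonneg fun _ => Finset.sum_nonneg fun _ _ =>
    mul_nonneg (loss_nonneg _ _) (weight_nonneg _ _ _)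

theorem IsPosterior.integral_pi {P : Measure (Bool × 𝒳)} [IsProbabilityMeasure P]
    {W : Bool → 𝒳 → ℝ} (hW : IsPosterior P W) (b : Bool) {n : ℕ} (i : Fin n)
    {g : (Fin n → 𝒳) → ℝ} (hg : Measurable g) (hg1 : ∀ x, |g x| ≤ 1) :
    ∫ ω, loss b (ω i).1 * g (fun j => (ω j).2) ∂(Measure.pi fun _ : Fin n => P) =
      ∫ ω, W b (ω i).2 * g (fun j => (ω j).2) ∂(Measure.pi fun _ : Fin n => P) := by
  obtain _ | n := n
  · exact i.elim0
  have hmp := (measurePreserving_piFinSuccAbove (fun _ : Fin (n + 1) => P) i).symm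
  have hgm : Measurable fun p : (Bool × 𝒳) × (Fin n → Bool × 𝒳) =>
      g fun j => (i.insertNth (α := fun _ => Bool × 𝒳) p.1 p.2 j).2 :=
    hg.comp (measurable_snd_pi.comp
      (MeasurableEquiv.piFinSuccAbove (fun _ => Bool × 𝒳) i).symm.measurable)
  have key : ∀ φ : Bool × 𝒳 → ℝ, Measurable φ → (∀ z, |φ z| ≤ 1) →
      ∫ ω, φ (ω i) * g (fun j => (ω j).2) ∂(Measure.pi fun _ : Fin (n + 1) => P) =
        ∫ ω', ∫ z, φ z * g (fun j => (i.insertNth (α := fun _ => Bool × 𝒳) z ω' j).2) ∂P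
          ∂(Measure.pi fun _ : Fin n => P) := by
    intro φ hφ hφ1
    rw [← hmp.integral_comp' (fun ω => φ (ω i) * g (fun j => (ω j).2))]
    refine Eq.trans ?_ (integral_prod_symm (fun p : (Bool × 𝒳) × (Fin n → Bool × 𝒳) =>
      φ p.1 * g fun j => (i.insertNth (α := fun _ => Bool × 𝒳) p.1 p.2 j).2) ?_)
    · refine integral_congr_ae (ae_of_all _ fun p => ?_)
      simp [MeasurableEquiv.piFinSuccAbove, Fin.insertNthEquiv]
    · refine integrable_of_bound ((hφ.comp measurable_fst).mul hgm) 1 fun p => ?_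
      rw [abs_mul]
      exact mul_le_one₀ (hφ1 _) (abs_nonneg _) (hg1 _)
  rw [key (fun z => loss b z.1) ((measurable_loss b).comp measurable_fst)
      fun z => abs_loss_le_one _ _,
    key (fun z => W b z.2) ((hW.meas b).comp measurable_snd) fun z => by
      rw [abs_of_nonneg (hW.nonneg b _)]
      exact hW.le_one b _]
  refine integral_congr_ae (ae_of_all _ fun ω' => ?_)
  have hx : ∀ z : Bool × 𝒳, (fun j => (i.insertNth (α := fun _ => Bool × 𝒳) z ω' j).2) =
      i.insertNth (α := fun _ => 𝒳) z.2 fun j => (ω' j).2 := by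
    intro z
    ext j
    refine Fin.succAboveCases i ?_ (fun j => ?_) j <;> simp
  simp only [hx]
  refine hW.integral_eq b (fun x => g (i.insertNth (α := fun _ => 𝒳) x fun j => (ω' j).2))
    (hg.comp ?_)
    fun x => hg1 _
  refine measurable_pi_lambda _ fun j => ?_
  refine Fin.succAboveCases i ?_ (fun j => ?_) j
  · simpa using measurable_id'
  · simp

theorem IsPosterior.risk_eq {P : Measure (Bool × 𝒳)} [IsProbabilityMeasure P]
    {W : Bool → 𝒳 → ℝ} (hW : IsPosterior P W) (b : Bool) {n : ℕ}
    {κ : (Fin n → 𝒳) → Measure (Fin n → Bool)} (hκ : IsRule κ) :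
    risk P b κ = ∫ ω, ∫ d, ∑ i, W b (ω i).2 * weight b d i ∂(κ fun i => (ω i).2)
      ∂(Measure.pi fun _ => P) := by
  rw [hκ.risk_eq, hκ.integral_weighted P b (φ := fun z => W b z.2)
    ((hW.meas b).comp measurable_snd) fun z => by
      rw [abs_of_nonneg (hW.nonneg b _)]
      exact hW.le_one b _]
  refine Finset.sum_congr rfl fun d _ => Finset.sum_congr rfl fun i _ => ?_
  rw [hW.integral_pi b i (hκ.measurable_real d) fun x => by
    rw [abs_of_nonneg measureReal_nonneg]
    exact hκ.real_le_one _ _]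

end Rules

section TestRules

variable {𝒳 : Type*} [MeasurableSpace 𝒳]

/-- The rule applying the test `q` independently to each coordinate. -/
noncomputable def testRule (q : Bool → 𝒳 → ℝ) (n : ℕ) :
    (Fin n → 𝒳) → Measure (Fin n → Bool) :=
  fun x => ∑ d : Fin n → Bool, ENNReal.ofReal (∏ i, q (d i) (x i)) • Measure.dirac d

variable {q : Bool → 𝒳 → ℝ}

theorem IsTest.prod_nonneg (hq : IsTest q) {n : ℕ} (d : Fin n → Bool) (x : Fin n → 𝒳) :
    0 ≤ ∏ i, q (d i) (x i) :=
  Finset.prod_nonneg fun _ _ => hq.nonneg _ _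

theorem prod_add_pi (n : ℕ) (p : Bool → Fin n → ℝ) :
    ∑ d : Fin n → Bool, ∏ i, p (d i) i = ∏ i, (p true i + p false i) := by
  have h := Finset.prod_univ_sum (fun _ : Fin n => (Finset.univ : Finset Bool)) fun i b => p b i
  rw [Fintype.piFinset_univ] at h
  rw [← h]
  simp

theorem testRule_singleton {𝒴 : Type*} (q : Bool → 𝒴 → ℝ) {n : ℕ} (x : Fin n → 𝒴)
    (d : Fin n → Bool) :
    testRule q n x {d} = ENNReal.ofReal (∏ i, q (d i) (x i)) := by
  simp only [testRule, Measure.finsetSum_apply, Measure.smul_apply, smul_eq_mul]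
  rw [Finset.sum_eq_single d]
  · simp
  · intro d' _ hd'
    simp [hd']
  · simp

theorem IsTest.testRule_real (hq : IsTest q) {n : ℕ} (x : Fin n → 𝒳) (d : Fin n → Bool) :
    (testRule q n x).real {d} = ∏ i, q (d i) (x i) := by
  rw [measureReal_def, testRule_singleton, ENNReal.toReal_ofReal (hq.prod_nonneg d x)]

theorem IsTest.isRule (hq : IsTest q) (n : ℕ) : IsRule (testRule q n) := by
  constructor
  · refine Measure.measurable_of_measurable_coe _ fun s _ => ?_
    simp only [testRule, Measure.finsetSum_apply, Measure.smul_apply, smul_eq_mul]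
    refine Finset.measurable_sum _ fun d _ => Measurable.mul_const ?_ _
    refine (Finset.measurable_prod _ fun i _ => ?_).ennreal_ofReal
    exact (hq.meas (d i)).comp (measurable_pi_apply i)
  · intro x
    constructor
    simp only [testRule, Measure.finsetSum_apply, Measure.smul_apply, smul_eq_mul, measure_univ,
      mul_one]
    rw [← ENNReal.ofReal_sum_of_nonneg fun d _ => hq.prod_nonneg d x,
      prod_add_pi n fun b i => q b (x i)]
    have h : ∀ i, q true (x i) + q false (x i) = 1 := fun i => hq.sum_one true (x i)
    simp [h]

theorem IsTest.integrable (hq : IsTest q) (P : Measure (Bool × 𝒳)) [IsProbabilityMeasure P]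
    (b : Bool) : Integrable (fun z => q b z.2) P :=
  integrable_of_bound ((hq.meas b).comp measurable_snd) 1 fun _ => hq.abs_le_one _ _

theorem IsTest.integrable_loss (hq : IsTest q) (P : Measure (Bool × 𝒳)) [IsProbabilityMeasure P]
    (b : Bool) : Integrable (fun z => loss b z.1 * q b z.2) P := by
  refine integrable_of_bound (((measurable_loss b).comp measurable_fst).mul
    ((hq.meas b).comp measurable_snd)) 1 fun z => ?_
  rw [abs_mul]
  exact mul_le_one₀ (abs_loss_le_one _ _) (abs_nonneg _) (hq.abs_le_one _ _)

theorem IsTest.integral_nonneg (hq : IsTest q) (P : Measure (Bool × 𝒳)) (b : Bool) :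
    0 ≤ ∫ z, q b z.2 ∂P :=
  MeasureTheory.integral_nonneg fun _ => hq.nonneg _ _

theorem IsTest.integral_loss_nonneg (hq : IsTest q) (P : Measure (Bool × 𝒳)) (b : Bool) :
    0 ≤ ∫ z, loss b z.1 * q b z.2 ∂P :=
  MeasureTheory.integral_nonneg fun _ => mul_nonneg (loss_nonneg _ _) (hq.nonneg _ _)

theorem IsTest.integral_loss_le (hq : IsTest q) (P : Measure (Bool × 𝒳)) [IsProbabilityMeasure P]
    (b : Bool) : ∫ z, loss b z.1 * q b z.2 ∂P ≤ ∫ z, q b z.2 ∂P :=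
  integral_mono (hq.integrable_loss P b) (hq.integrable P b) fun _ =>
    mul_le_of_le_one_left (hq.nonneg _ _) (loss_le_one _ _)

theorem IsTest.rate_nonneg (hq : IsTest q) (P : Measure (Bool × 𝒳)) (b : Bool) :
    0 ≤ rate P b q :=
  div_nonneg (hq.integral_loss_nonneg P b) (hq.integral_nonneg P b)

theorem IsTest.rate_le_one (hq : IsTest q) (P : Measure (Bool × 𝒳)) [IsProbabilityMeasure P]
    (b : Bool) : rate P b q ≤ 1 :=
  div_le_one_of_le₀ (hq.integral_loss_le P b) (hq.integral_nonneg P b)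

theorem IsTest.integral_loss_eq (hq : IsTest q) (P : Measure (Bool × 𝒳)) [IsProbabilityMeasure P]
    (b : Bool) : ∫ z, loss b z.1 * q b z.2 ∂P = rate P b q * ∫ z, q b z.2 ∂P := by
  by_cases h : ∫ z, q b z.2 ∂P = 0
  · have h1 := hq.integral_loss_nonneg P b
    have h2 := hq.integral_loss_le P b
    rw [h] at h2 ⊢
    linarith
  · exact (div_mul_cancel₀ _ h).symm

theorem IsTest.risk_testRule_le (hq : IsTest q) (P : Measure (Bool × 𝒳)) [IsProbabilityMeasure P]
    (b : Bool) (n : ℕ) : risk P b (testRule q n) ≤ rate P b q := by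
  have hterm : ∀ (d : Fin n → Bool) (i : Fin n), weight b d i *
      ∫ ω, loss b (ω i).1 * (testRule q n fun j => (ω j).2).real {d}
        ∂(Measure.pi fun _ : Fin n => P) =
      rate P b q * (weight b d i * ∏ j, ∫ z, q (d j) z.2 ∂P) := by
    intro d i
    by_cases hdi : d i = b
    · have h1 : ∀ ω : Fin n → Bool × 𝒳,
          loss b (ω i).1 * (testRule q n fun j => (ω j).2).real {d} =
            ∏ j, (if j = i then loss b (ω j).1 else 1) * q (d j) (ω j).2 := by
        intro ω
        rw [hq.testRule_real, Finset.prod_mul_distrib]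
        simp
      simp_rw [h1]
      rw [integral_fintype_prod_eq_prod
        (f := fun (j : Fin n) (z : Bool × 𝒳) => (if j = i then loss b z.1 else 1) * q (d j) z.2),
        ← Finset.mul_prod_erase _ _ (Finset.mem_univ i),
        ← Finset.mul_prod_erase _ (fun j => ∫ z, q (d j) z.2 ∂P) (Finset.mem_univ i)]
      have h2 : ∏ j ∈ Finset.univ.erase i,
          ∫ z, (if j = i then loss b z.1 else 1) * q (d j) z.2 ∂P =
          ∏ j ∈ Finset.univ.erase i, ∫ z, q (d j) z.2 ∂P :=
        Finset.prod_congr rfl fun j hj => by simp [Finset.ne_of_mem_erase hj]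
      rw [h2]
      simp only [if_true, hdi]
      rw [hq.integral_loss_eq P b]
      ring
    · simp [weight, hdi]
  rw [(hq.isRule n).risk_eq P b]
  simp_rw [hterm, ← Finset.mul_sum, ← Finset.sum_mul]
  refine mul_le_of_le_one_right (hq.rate_nonneg P b) ?_
  calc ∑ d, (∑ i, weight b d i) * ∏ j, ∫ z, q (d j) z.2 ∂P
      ≤ ∑ d : Fin n → Bool, ∏ j, ∫ z, q (d j) z.2 ∂P :=
        Finset.sum_le_sum fun d _ => mul_le_of_le_one_left
          (Finset.prod_nonneg fun j _ => hq.integral_nonneg P _) (sum_weight_le_one b d)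
    _ = 1 := by
        rw [prod_add_pi n fun b _ => ∫ z, q b z.2 ∂P]
        rw [← integral_add (hq.integrable P true) (hq.integrable P false)]
        have h : ∀ z : Bool × 𝒳, q true z.2 + q false z.2 = 1 := fun z => hq.sum_one true z.2
        simp [h]

/-- The single-hypothesis test underlying a rule for one hypothesis. -/
noncomputable def ruleTest (κ : (Fin 1 → 𝒳) → Measure (Fin 1 → Bool)) (b : Bool) (x : 𝒳) : ℝ :=
  (κ fun _ => x).real {fun _ => b}

theorem sum_fin_one_bool (F : (Fin 1 → Bool) → ℝ) :
    ∑ d, F d = F (fun _ => true) + F fun _ => false := by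
  rw [← (Equiv.funUnique (Fin 1) Bool).symm.sum_comp, Fintype.sum_bool]
  rfl

theorem IsRule.isTest {κ : (Fin 1 → 𝒳) → Measure (Fin 1 → Bool)} (hκ : IsRule κ) :
    IsTest (ruleTest κ) where
  meas b := (hκ.measurable_real _).comp (measurable_pi_lambda _ fun _ => measurable_id)
  nonneg _ _ := measureReal_nonneg
  sum_one b x := by
    have := hκ.2 fun _ => x
    have h := hκ.integral_eq (fun _ => 1) fun _ => x
    rw [sum_fin_one_bool] at h
    simp at h
    cases b <;> simp [ruleTest] <;> linarith

theorem IsRule.integral_fin_one {κ : (Fin 1 → 𝒳) → Measure (Fin 1 → Bool)} (hκ : IsRule κ)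
    (P : Measure (Bool × 𝒳)) [IsProbabilityMeasure P] (F : (Fin 1 → Bool) → (Fin 1 → Bool) → ℝ) :
    ∫ ω, ∫ d, F (fun i => (ω i).1) d ∂(κ fun i => (ω i).2) ∂(Measure.pi fun _ => P) =
      ∫ z, (ruleTest κ true z.2 * F (fun _ => z.1) (fun _ => true) +
        ruleTest κ false z.2 * F (fun _ => z.1) fun _ => false) ∂P := by
  simp_rw [hκ.integral_eq, sum_fin_one_bool]
  have h := (measurePreserving_funUnique P (Fin 1)).integral_comp' (fun z =>
    ruleTest κ true z.2 * F (fun _ => z.1) (fun _ => true) +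
      ruleTest κ false z.2 * F (fun _ => z.1) fun _ => false)
  rw [← h]
  have hω : ∀ (ω : Fin 1 → Bool × 𝒳) (i : Fin 1), ω i = ω 0 := fun ω i => by
    rw [Subsingleton.elim i 0]
  simp_rw [hω]
  convert! rfl

theorem Model.mFDR_eq_rate (M : Model 𝒳) {κ : (Fin 1 → 𝒳) → Measure (Fin 1 → Bool)}
    (hκ : IsRule κ) : M.mFDR 1 κ = rate M.joint true (ruleTest κ) := by
  have := M.isProbabilityMeasure_joint
  unfold Model.mFDR Model.jointN rate
  rw [hκ.integral_fin_one M.joint nFD, hκ.integral_fin_one M.joint fun _ d => nRej d]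
  simp [nFD, nRej, loss]

theorem Model.mFNR_eq_rate (M : Model 𝒳) {κ : (Fin 1 → 𝒳) → Measure (Fin 1 → Bool)}
    (hκ : IsRule κ) : M.mFNR 1 κ = rate M.joint false (ruleTest κ) := by
  have := M.isProbabilityMeasure_joint
  have h : ∀ t : Bool, (if t = true then (1 : ℝ) else 0) = loss false t := by
    intro t
    cases t <;> simp [loss]
  unfold Model.mFNR Model.jointN rate
  rw [hκ.integral_fin_one M.joint nFN, hκ.integral_fin_one M.joint fun _ d => nAcc d]
  simp [nFN, nAcc, h, mul_comm]

theorem IsTest.ruleTest_testRule (hq : IsTest q) : ruleTest (testRule q 1) = q := by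
  ext b x
  rw [ruleTest, hq.testRule_real]
  simp

/-- The mixture of two rules. -/
noncomputable def mixRule {n : ℕ} (s t : ℝ) (κ κ' : (Fin n → 𝒳) → Measure (Fin n → Bool)) :
    (Fin n → 𝒳) → Measure (Fin n → Bool) :=
  fun x => ENNReal.ofReal s • κ x + ENNReal.ofReal t • κ' x

theorem IsRule.mix {n : ℕ} {κ κ' : (Fin n → 𝒳) → Measure (Fin n → Bool)} (hκ : IsRule κ)
    (hκ' : IsRule κ') {s t : ℝ} (hs : 0 ≤ s) (ht : 0 ≤ t) (hst : s + t = 1) :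
    IsRule (mixRule s t κ κ') := by
  constructor
  · refine Measure.measurable_of_measurable_coe _ fun E hE => ?_
    simp only [mixRule, Measure.add_apply, Measure.smul_apply, smul_eq_mul]
    exact (((Measure.measurable_coe hE).comp hκ.1).const_mul _).add
      (((Measure.measurable_coe hE).comp hκ'.1).const_mul _)
  · intro x
    have := hκ.2 x
    have := hκ'.2 x
    constructor
    simp only [mixRule, Measure.add_apply, Measure.smul_apply, smul_eq_mul, measure_univ, mul_one]
    rw [← ENNReal.ofReal_add hs ht, hst, ENNReal.ofReal_one]

theorem IsRule.risk_mix {n : ℕ} {κ κ' : (Fin n → 𝒳) → Measure (Fin n → Bool)} (hκ : IsRule κ)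
    (hκ' : IsRule κ') {s t : ℝ} (hs : 0 ≤ s) (ht : 0 ≤ t) (hst : s + t = 1)
    (P : Measure (Bool × 𝒳)) [IsProbabilityMeasure P] (b : Bool) :
    risk P b (mixRule s t κ κ') = s * risk P b κ + t * risk P b κ' := by
  have hreal : ∀ x d, (mixRule s t κ κ' x).real {d} =
      s * (κ x).real {d} + t * (κ' x).real {d} := by
    intro x d
    have := hκ.2 x
    have := hκ'.2 x
    simp only [mixRule]
    rw [measureReal_def, Measure.add_apply, Measure.smul_apply, Measure.smul_apply, smul_eq_mul,
      smul_eq_mul, ENNReal.toReal_add (by finiteness) (by finiteness), ENNReal.toReal_mul,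
      ENNReal.toReal_mul, ENNReal.toReal_ofReal hs, ENNReal.toReal_ofReal ht]
    rfl
  have h_int : ∀ {κ : (Fin n → 𝒳) → Measure (Fin n → Bool)}, IsRule κ → ∀ d (i : Fin n), Integrable
      (fun ω : Fin n → Bool × 𝒳 => loss b (ω i).1 * (κ fun j => (ω j).2).real {d})
      (Measure.pi fun _ => P) := by
    intro κ hκ d i
    refine integrable_of_bound (((measurable_loss b).comp
      (measurable_fst.comp (measurable_pi_apply i))).mul
      ((hκ.measurable_real d).comp measurable_snd_pi)) 1 fun ω => ?_
    rw [abs_mul]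
    refine mul_le_one₀ (abs_loss_le_one _ _) (abs_nonneg _) ?_
    rw [abs_of_nonneg measureReal_nonneg]
    exact hκ.real_le_one _ _
  rw [(hκ.mix hκ' hs ht hst).risk_eq, hκ.risk_eq, hκ'.risk_eq, Finset.mul_sum, Finset.mul_sum,
    ← Finset.sum_add_distrib]
  refine Finset.sum_congr rfl fun d _ => ?_
  rw [Finset.mul_sum, Finset.mul_sum, ← Finset.sum_add_distrib]
  refine Finset.sum_congr rfl fun i _ => ?_
  have hx : ∀ ω : Fin n → Bool × 𝒳,
      loss b (ω i).1 * (mixRule s t κ κ' fun j => (ω j).2).real {d} =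
      s * (loss b (ω i).1 * (κ fun j => (ω j).2).real {d}) +
        t * (loss b (ω i).1 * (κ' fun j => (ω j).2).real {d}) := by
    intro ω
    rw [hreal]
    ring
  simp_rw [hx]
  rw [integral_add ((h_int hκ d i).const_mul _) ((h_int hκ' d i).const_mul _), integral_const_mul,
    integral_const_mul]
  ring

/-- The test that always takes decision `b₀`. -/
def constTest (b₀ b : Bool) (_ : 𝒳) : ℝ := if b = b₀ then 1 else 0

theorem isTest_constTest (b₀ : Bool) : IsTest (constTest b₀ : Bool → 𝒳 → ℝ) where
  meas b := measurable_const
  nonneg b x := by unfold constTest; split_ifs <;> simp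
  sum_one b x := by cases b <;> cases b₀ <;> simp [constTest]

theorem rate_constTest (P : Measure (Bool × 𝒳)) (b : Bool) : rate P b (constTest (!b)) = 0 := by
  simp [rate, constTest]

namespace Model

variable (M : Model 𝒳)

theorem bddBelow_FNR (n : ℕ) (α : ℝ) : BddBelow {r | ∃ κ : (Fin n → 𝒳) → Measure (Fin n → Bool),
    IsRule κ ∧ M.FDR n κ ≤ α ∧ r = M.FNR n κ} := by
  refine ⟨0, ?_⟩
  rintro _ ⟨κ, -, -, rfl⟩
  rw [M.FNR_eq_risk]
  exact risk_nonneg _ _ _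

theorem FNRstar_le {n : ℕ} {α : ℝ} {κ : (Fin n → 𝒳) → Measure (Fin n → Bool)} (hκ : IsRule κ)
    (h : M.FDR n κ ≤ α) : M.FNRstar n α ≤ M.FNR n κ :=
  csInf_le (M.bddBelow_FNR n α) ⟨κ, hκ, h, rfl⟩

theorem FNRstar_nonneg (n : ℕ) (α : ℝ) : 0 ≤ M.FNRstar n α := by
  refine Real.sInf_nonneg ?_
  rintro _ ⟨κ, -, -, rfl⟩
  rw [M.FNR_eq_risk]
  exact risk_nonneg _ _ _

theorem nonempty_FNR (n : ℕ) {α : ℝ} (hα : 0 ≤ α) :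
    {r | ∃ κ : (Fin n → 𝒳) → Measure (Fin n → Bool),
      IsRule κ ∧ M.FDR n κ ≤ α ∧ r = M.FNR n κ}.Nonempty := by
  have := M.isProbabilityMeasure_joint
  refine ⟨_, testRule (constTest false) n, (isTest_constTest false).isRule n, ?_, rfl⟩
  rw [M.FDR_eq_risk]
  refine ((isTest_constTest false).risk_testRule_le M.joint true n).trans ?_
  rw [show false = !true from rfl, rate_constTest]
  exact hα

theorem exists_rule_lt (n : ℕ) {α : ℝ} (hα : 0 ≤ α) {ε : ℝ} (hε : 0 < ε) :
    ∃ κ : (Fin n → 𝒳) → Measure (Fin n → Bool),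
      IsRule κ ∧ M.FDR n κ ≤ α ∧ M.FNR n κ < M.FNRstar n α + ε := by
  obtain ⟨_, ⟨κ, hκ, h, rfl⟩, hlt⟩ := Real.lt_sInf_add_pos (M.nonempty_FNR n hα) hε
  exact ⟨κ, hκ, h, hlt⟩

theorem convexOn_FNRstar (n : ℕ) : ConvexOn ℝ (Set.Icc 0 1) (M.FNRstar n) := by
  have := M.isProbabilityMeasure_joint
  refine ⟨convex_Icc 0 1, fun x hx y hy s t hs ht hst => le_of_forall_pos_le_add fun ε hε => ?_⟩
  obtain ⟨κ, hκ, h, hlt⟩ := M.exists_rule_lt n hx.1 hε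
  obtain ⟨κ', hκ', h', hlt'⟩ := M.exists_rule_lt n hy.1 hε
  have hle := M.FNRstar_le (hκ.mix hκ' hs ht hst) (α := s • x + t • y) (by
    rw [FDR_eq_risk] at h h' ⊢
    rw [hκ.risk_mix hκ' hs ht hst, smul_eq_mul, smul_eq_mul]
    gcongr)
  refine hle.trans ?_
  rw [FNR_eq_risk] at hlt hlt' ⊢
  rw [hκ.risk_mix hκ' hs ht hst, smul_eq_mul, smul_eq_mul]
  calc s * risk M.joint false κ + t * risk M.joint false κ'
      ≤ s * (M.FNRstar n x + ε) + t * (M.FNRstar n y + ε) := by gcongr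
    _ = s * M.FNRstar n x + t * M.FNRstar n y + (s + t) * ε := by ring
    _ = _ := by rw [hst, one_mul]

theorem mFNRstar_le_rate {q : Bool → 𝒳 → ℝ} (hq : IsTest q) {α : ℝ}
    (h : rate M.joint true q ≤ α) : M.mFNRstar α ≤ rate M.joint false q := by
  have hr := hq.isRule 1
  refine csInf_le ⟨0, ?_⟩ ⟨testRule q 1, hr, ?_, ?_⟩
  · rintro _ ⟨κ, hκ, -, rfl⟩
    rw [M.mFNR_eq_rate hκ]
    exact hκ.isTest.rate_nonneg _ _
  · rwa [M.mFDR_eq_rate hr, hq.ruleTest_testRule]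
  · rw [M.mFNR_eq_rate hr, hq.ruleTest_testRule]

theorem le_mFNRstar {α c : ℝ} (hα : 0 ≤ α)
    (h : ∀ q, IsTest q → rate M.joint true q ≤ α → c ≤ rate M.joint false q) :
    c ≤ M.mFNRstar α := by
  refine le_csInf ?_ ?_
  · have hr := (isTest_constTest (𝒳 := 𝒳) false).isRule 1
    refine ⟨_, _, hr, ?_, rfl⟩
    rw [M.mFDR_eq_rate hr, (isTest_constTest false).ruleTest_testRule,
      show false = !true from rfl, rate_constTest]
    exact hα
  · rintro _ ⟨κ, hκ, hle, rfl⟩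
    rw [M.mFNR_eq_rate hκ]
    rw [M.mFDR_eq_rate hκ] at hle
    exact h _ hκ.isTest hle

theorem FNRstar_le_mFNRstar (n : ℕ) {α : ℝ} (hα : 0 ≤ α) : M.FNRstar n α ≤ M.mFNRstar α := by
  have := M.isProbabilityMeasure_joint
  refine M.le_mFNRstar hα fun q hq hle => ?_
  refine (M.FNRstar_le (hq.isRule n) ?_).trans ?_
  · rw [FDR_eq_risk]
    exact (hq.risk_testRule_le _ _ _).trans hle
  · rw [FNR_eq_risk]
    exact hq.risk_testRule_le _ _ _

theorem mFNRstar_nonneg {α : ℝ} (hα : 0 ≤ α) : 0 ≤ M.mFNRstar α :=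
  M.le_mFNRstar hα fun _ hq _ => hq.rate_nonneg _ _

theorem mFNRstar_one : M.mFNRstar 1 = 0 := by
  have := M.isProbabilityMeasure_joint
  refine le_antisymm ?_ (M.mFNRstar_nonneg zero_le_one)
  refine (M.mFNRstar_le_rate (isTest_constTest true)
    ((isTest_constTest true).rate_le_one _ _)).trans_eq ?_
  exact rate_constTest M.joint false

theorem FNRstar_le_gcm (n : ℕ) {α : ℝ} (hα : α ∈ Set.Icc (0 : ℝ) 1) :
    M.FNRstar n α ≤ gcm M.mFNRstar α := by
  refine le_csSup ⟨M.mFNRstar α, ?_⟩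
    ⟨M.FNRstar n, M.convexOn_FNRstar n, fun t ht => M.FNRstar_le_mFNRstar n ht.1, rfl⟩
  rintro _ ⟨C, -, hC, rfl⟩
  exact hC α hα

end Model

end TestRules

section EmpiricalTest

variable {𝒳 : Type*} [MeasurableSpace 𝒳]

theorem cnt_eq_zero_or_one_le {n : ℕ} (b : Bool) (d : Fin n → Bool) :
    cnt b d = 0 ∨ 1 ≤ cnt b d := by
  have h : cnt b d = ((Finset.univ.filter fun i => d i = b).card : ℝ) := by simp [cnt]
  rw [h]
  rcases Nat.eq_zero_or_pos (Finset.univ.filter fun i => d i = b).card with h0 | h0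
  · left; exact_mod_cast h0
  · right; exact_mod_cast h0

theorem cnt_add_cnt_not {n : ℕ} (b : Bool) (d : Fin n → Bool) : cnt b d + cnt (!b) d = n := by
  unfold cnt
  rw [← Finset.sum_add_distrib]
  have h : ∀ i, ((if d i = b then (1 : ℝ) else 0) + if d i = !b then 1 else 0) = 1 := by
    intro i
    cases d i <;> cases b <;> simp
  simp [h]

theorem sum_weight_eq {n : ℕ} (b : Bool) (d : Fin n → Bool) (w : Fin n → ℝ) :
    ∑ i, w i * weight b d i = (∑ i, if d i = b then w i else 0) / max 1 (cnt b d) := by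
  rw [Finset.sum_div]
  refine Finset.sum_congr rfl fun i _ => ?_
  unfold weight
  split_ifs <;> ring

/-- Indicator of the bin `j` of a partition given by `bin`. -/
def binIndicator {𝒴 : Type*} {K : ℕ} (bin : 𝒴 → Fin K) (j : Fin K) (y : 𝒴) : ℝ :=
  if bin y = j then 1 else 0

theorem binIndicator_nonneg {𝒴 : Type*} {K : ℕ} (bin : 𝒴 → Fin K) (j : Fin K) (y : 𝒴) :
    0 ≤ binIndicator bin j y := by
  unfold binIndicator; split_ifs <;> simp

theorem binIndicator_le_one {𝒴 : Type*} {K : ℕ} (bin : 𝒴 → Fin K) (j : Fin K) (y : 𝒴) :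
    binIndicator bin j y ≤ 1 := by
  unfold binIndicator; split_ifs <;> simp

theorem measurable_binIndicator {K : ℕ} {bin : 𝒳 → Fin K} (hbin : Measurable bin) (j : Fin K) :
    Measurable (binIndicator bin j) :=
  (measurable_of_countable fun i : Fin K => if i = j then (1 : ℝ) else 0).comp hbin

theorem IsTest.rate_eq {P : Measure (Bool × 𝒳)} {W q : Bool → 𝒳 → ℝ} (hq : IsTest q)
    (hW : IsPosterior P W) (b : Bool) :
    rate P b q = (∫ z, W b z.2 * q b z.2 ∂P) / ∫ z, q b z.2 ∂P := by
  rw [rate]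
  congr 1
  exact hW.integral_eq b (q b) (hq.meas b) (hq.abs_le_one b)

theorem IsPosterior.exists_test {P : Measure (Bool × 𝒳)} [IsProbabilityMeasure P]
    {W : Bool → 𝒳 → ℝ} (hW : IsPosterior P W) {K : ℕ} {bin : 𝒳 → Fin K} (hbin : Measurable bin)
    {ρ η : ℝ} (hρ : 0 ≤ ρ) (hη : 0 ≤ η)
    (hclose : ∀ b x y, bin x = bin y → |W b x - W b y| ≤ ρ) {n : ℕ} (hn : 0 < n)
    (x : Fin n → 𝒳)
    (hN : ∀ j, ∑ i, binIndicator bin j (x i) ≤ (1 + η) * n * ∫ z, binIndicator bin j z.2 ∂P)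
    (hA : ∀ b, ∫ z, W b z.2 ∂P ≤ (∑ i, W b (x i)) / n + η) (d : Fin n → Bool) :
    ∃ q, IsTest q ∧
      ∀ b, rate P b q ≤ ∑ i, W b (x i) * weight b d i + (4 * η + 2 * ρ) := by
  have hn' : (0 : ℝ) < n := by exact_mod_cast hn
  obtain ⟨b, hb⟩ : ∃ b, cnt b d ≤ n / 2 := by
    by_contra! h
    have := cnt_add_cnt_not true d
    have h1 := h true
    have h2 := h false
    simp only [Bool.not_true] at this
    linarith
  set k := cnt b d with hk
  have hk0 : 0 ≤ k := cnt_nonneg b d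
  set T : ℝ := (1 + η) * n with hT
  have hT0 : 0 < T := by positivity
  have hnT : n ≤ T := by nlinarith
  set p : Fin K → ℝ := fun j => ∫ z, binIndicator bin j z.2 ∂P with hp
  have hp0 : ∀ j, 0 ≤ p j := fun j => integral_nonneg fun z => binIndicator_nonneg _ _ _
  have hppos : ∀ i, 0 < p (bin (x i)) := by
    intro i
    have h1 : (1 : ℝ) ≤ ∑ i', binIndicator bin (bin (x i)) (x i') := by
      refine le_trans ?_ (Finset.single_le_sum (fun i' _ => binIndicator_nonneg _ _ _)
        (Finset.mem_univ i))
      simp [binIndicator]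
    have h2 : 1 ≤ T * p (bin (x i)) := h1.trans (hN _)
    exact pos_of_mul_pos_right (one_pos.trans_le h2) hT0.le
  set ι : Fin n → ℝ := fun i => if d i = b then 1 else 0 with hι
  have hι0 : ∀ i, 0 ≤ ι i := fun i => by simp only [hι]; split_ifs <;> simp
  have hι1 : ∀ i, ι i ≤ 1 := fun i => by simp only [hι]; split_ifs <;> simp
  set u : 𝒳 → ℝ := fun y => ∑ i, ι i / (T * p (bin (x i))) * binIndicator bin (bin (x i)) y with hu
  have hum : Measurable u :=
    Finset.measurable_sum _ fun i _ => (measurable_binIndicator hbin _).const_mul _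
  have hu0 : ∀ y, 0 ≤ u y := fun y => Finset.sum_nonneg fun i _ =>
    mul_nonneg (div_nonneg (hι0 i) (mul_nonneg hT0.le (hp0 _))) (binIndicator_nonneg _ _ _)
  have hu1 : ∀ y, u y ≤ 1 := by
    intro y
    calc u y ≤ ∑ i, binIndicator bin (bin y) (x i) / (T * p (bin y)) := by
          refine Finset.sum_le_sum fun i _ => ?_
          by_cases h : bin y = bin (x i)
          · simp only [binIndicator, h, if_true, mul_one]
            have := mul_nonneg hT0.le (hp0 (bin (x i)))
            gcongr
            exact hι1 i
          · simp [binIndicator, h, Ne.symm h]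
      _ ≤ 1 := by
          rw [← Finset.sum_div]
          exact div_le_one_of_le₀ (hN _) (mul_nonneg hT0.le (hp0 _))
  have hsbi : ∀ (w : 𝒳 → ℝ) (j : Fin K), Measurable w → (∀ y, |w y| ≤ 1) →
      Integrable (fun z : Bool × 𝒳 => w z.2 * binIndicator bin j z.2) P := by
    intro w j hw hw1
    refine integrable_of_bound ((hw.comp measurable_snd).mul
      ((measurable_binIndicator hbin j).comp measurable_snd)) 1 fun z => ?_
    rw [abs_mul, abs_of_nonneg (binIndicator_nonneg _ _ _)]
    exact mul_le_one₀ (hw1 _) (binIndicator_nonneg _ _ _) (binIndicator_le_one _ _ _)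
  have hWabs : ∀ b' y, |W b' y| ≤ 1 := fun b' y => by
    rw [abs_of_nonneg (hW.nonneg b' y)]
    exact hW.le_one b' y
  have hwu : ∀ w : 𝒳 → ℝ, Measurable w → (∀ y, |w y| ≤ 1) → ∫ z, w z.2 * u z.2 ∂P =
      ∑ i, ι i / (T * p (bin (x i))) * ∫ z, w z.2 * binIndicator bin (bin (x i)) z.2 ∂P := by
    intro w hw hw1
    have h : ∀ z : Bool × 𝒳, w z.2 * u z.2 = ∑ i, ι i / (T * p (bin (x i))) *
        (w z.2 * binIndicator bin (bin (x i)) z.2) := by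
      intro z
      rw [hu, Finset.mul_sum]
      exact Finset.sum_congr rfl fun i _ => by ring
    simp_rw [h]
    rw [integral_finsetSum _ fun i _ => (hsbi w _ hw hw1).const_mul _]
    exact Finset.sum_congr rfl fun i _ => integral_const_mul _ _
  have huint : ∫ z, u z.2 ∂P = k / T := by
    have h := hwu (fun _ => 1) measurable_const (by simp)
    simp only [one_mul] at h
    rw [h, hk, cnt, Finset.sum_div]
    refine Finset.sum_congr rfl fun i _ => ?_
    have := (hppos i).ne'
    change ι i / (T * p (bin (x i))) * p (bin (x i)) = ι i / T
    field_simp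
  have hcell : ∀ b' i, |(∫ z, W b' z.2 * binIndicator bin (bin (x i)) z.2 ∂P) -
      W b' (x i) * p (bin (x i))| ≤ ρ * p (bin (x i)) := by
    intro b' i
    rw [hp, ← integral_const_mul, ← integral_const_mul, ← integral_sub
      (hsbi _ _ (hW.meas b') (hWabs b')) ?_]
    · refine abs_integral_le_integral_abs.trans (integral_mono_of_nonneg
        (ae_of_all _ fun z => abs_nonneg _) ?_ (ae_of_all _ fun z => ?_))
      · simpa using (hsbi (fun _ => 1) _ measurable_const (by simp)).const_mul ρ
      · simp only [← sub_mul, abs_mul, abs_of_nonneg (binIndicator_nonneg bin (bin (x i)) z.2)]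
        by_cases h : bin z.2 = bin (x i)
        · exact mul_le_mul_of_nonneg_right (hclose _ _ _ h) (binIndicator_nonneg _ _ _)
        · simp [binIndicator, h]
    · exact (by simpa using (hsbi (fun _ => 1) (bin (x i)) measurable_const (by simp)) :
        Integrable (fun z : Bool × 𝒳 => binIndicator bin (bin (x i)) z.2) P).const_mul _
  set S : Bool → ℝ := fun b' => ∑ i, ι i * W b' (x i) with hS
  have hI : ∀ b', |∫ z, W b' z.2 * u z.2 ∂P - S b' / T| ≤ ρ * k / T := by
    intro b'
    rw [hwu _ (hW.meas b') (hWabs b'), hS, Finset.sum_div, ← Finset.sum_sub_distrib]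
    refine (Finset.abs_sum_le_sum_abs _ _).trans ?_
    rw [hk, cnt, Finset.mul_sum, Finset.sum_div]
    refine Finset.sum_le_sum fun i _ => ?_
    have hpi := hppos i
    have h1 : ι i / (T * p (bin (x i))) * (∫ z, W b' z.2 * binIndicator bin (bin (x i)) z.2 ∂P) -
        ι i * W b' (x i) / T = ι i / (T * p (bin (x i))) *
          ((∫ z, W b' z.2 * binIndicator bin (bin (x i)) z.2 ∂P) - W b' (x i) * p (bin (x i))) := by
      field_simp
    have h2 : 0 ≤ ι i / (T * p (bin (x i))) := div_nonneg (hι0 i) (by positivity)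
    rw [h1, abs_mul, abs_of_nonneg h2]
    refine (mul_le_mul_of_nonneg_left (hcell b' i) h2).trans_eq ?_
    change _ = ρ * ι i / T
    field_simp
  have hSk : ∀ b', S b' ≤ k := fun b' => Finset.sum_le_sum fun i _ =>
    mul_le_of_le_one_right (hι0 i) (hW.le_one _ _)
  have hS0 : ∀ b', 0 ≤ S b' := fun b' => Finset.sum_nonneg fun i _ =>
    mul_nonneg (hι0 i) (hW.nonneg _ _)
  set q : Bool → 𝒳 → ℝ := fun b' y => if b' = b then u y else 1 - u y with hqdef
  have hq : IsTest q := by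
    refine ⟨fun b' => ?_, fun b' y => ?_, fun b' y => ?_⟩
    · by_cases h : b' = b
      · simpa [hqdef, h] using hum
      · simpa [hqdef, h] using hum.const_sub 1
    · have := hu0 y
      have := hu1 y
      simp only [hqdef]
      split_ifs <;> linarith
    · cases b' <;> cases b <;> simp [hqdef]
  refine ⟨q, hq, fun b' => ?_⟩
  rw [hq.rate_eq hW, sum_weight_eq]
  by_cases hbb : b' = b
  · subst hbb
    have hsum : (∑ i, if d i = b' then W b' (x i) else 0) = S b' :=
      Finset.sum_congr rfl fun i _ => by simp [hι]
    simp only [hqdef, if_true, hsum]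
    rw [huint]
    rcases cnt_eq_zero_or_one_le b' d with h0 | h1
    · rw [← hk] at h0
      rw [h0, zero_div, div_zero]
      exact add_nonneg (div_nonneg (hS0 b') (by positivity)) (by positivity)
    · rw [← hk] at h1 ⊢
      have hkpos : 0 < k := one_pos.trans_le h1
      rw [max_eq_right h1, div_le_iff₀ (by positivity)]
      have h2 := (abs_le.1 (hI b')).2
      have h3 : (S b' / k + (4 * η + 2 * ρ)) * (k / T) =
          S b' / T + ρ * k / T + (4 * η + ρ) * k / T := by
        field_simp
        ring
      have h4 : 0 ≤ (4 * η + ρ) * k / T := by positivity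
      linarith
  · have hb' : b' = !b := Bool.eq_not_of_ne hbb
    have hsum : (∑ i, W b' (x i)) = S b' + ∑ i, if d i = b' then W b' (x i) else 0 := by
      rw [hS, ← Finset.sum_add_distrib]
      refine Finset.sum_congr rfl fun i _ => ?_
      rw [hb', hι]
      by_cases h : d i = b
      · simp [h]
      · have : d i = !b := Bool.eq_not_of_ne h
        simp [this]
    set R := ∑ i, if d i = b' then W b' (x i) else 0 with hR
    have hR0 : 0 ≤ R := Finset.sum_nonneg fun i _ => by
      split_ifs
      · exact hW.nonneg _ _
      · exact le_rfl
    have hcnt : cnt b' d = n - k := by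
      have := cnt_add_cnt_not b d
      rw [hb']
      linarith
    have hcnt1 : 1 ≤ (n : ℝ) - k := by
      rcases cnt_eq_zero_or_one_le b' d with h0 | h1
      · rw [hcnt] at h0
        linarith
      · rwa [hcnt] at h1
    simp only [hqdef, if_neg hbb]
    have hui : Integrable (fun z : Bool × 𝒳 => u z.2) P :=
      integrable_of_bound (hum.comp measurable_snd) 1 fun z => by
        rw [abs_of_nonneg (hu0 _)]
        exact hu1 _
    have hWi : Integrable (fun z : Bool × 𝒳 => W b' z.2) P :=
      integrable_of_bound ((hW.meas b').comp measurable_snd) 1 fun z => hWabs _ _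
    have hden : ∫ z, (1 - u z.2) ∂P = 1 - k / T := by
      rw [integral_sub (integrable_const _) hui, huint]
      simp
    have hnum : ∫ z, W b' z.2 * (1 - u z.2) ∂P =
        ∫ z, W b' z.2 ∂P - ∫ z, W b' z.2 * u z.2 ∂P := by
      rw [← integral_sub hWi]
      · exact integral_congr_ae (ae_of_all _ fun z => by ring)
      · refine integrable_of_bound (((hW.meas b').comp measurable_snd).mul
          (hum.comp measurable_snd)) 1 fun z => ?_
        rw [abs_mul, abs_of_nonneg (hu0 _)]
        exact mul_le_one₀ (hWabs _ _) (hu0 _) (hu1 _)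
    rw [hden, hnum, hcnt, max_eq_right hcnt1]
    have hkn : k / T ≤ k / n := by gcongr
    have hkn2 : k / n ≤ 1 / 2 := by
      rw [div_le_iff₀ hn']
      linarith
    have hD : 0 < 1 - k / T := by linarith
    have h2 := (abs_le.1 (hI b')).1
    have h3 := hA b'
    rw [hsum] at h3
    have h4 : S b' / n - S b' / T ≤ η := by
      have : S b' / n - S b' / T = η * (S b' / T) := by
        rw [hT]
        field_simp
        ring
      rw [this]
      refine mul_le_of_le_one_right hη (div_le_one_of_le₀ ?_ hT0.le)
      linarith [hSk b']
    have h5 : ρ * k / T ≤ ρ := by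
      rw [mul_div_assoc]
      exact mul_le_of_le_one_right hρ (by linarith)
    have h6 : ∫ z, W b' z.2 ∂P - ∫ z, W b' z.2 * u z.2 ∂P ≤ R / n + (2 * η + ρ) := by
      rw [add_div] at h3
      linarith
    rw [div_le_iff₀ hD]
    refine h6.trans ?_
    have h7 : (R / (n - k) + (4 * η + 2 * ρ)) * (1 - k / n) =
        R / n + (4 * η + 2 * ρ) * (1 - k / n) := by
      have : (n : ℝ) - k ≠ 0 := by linarith
      field_simp
    have h8 : (R / (n - k) + (4 * η + 2 * ρ)) * (1 - k / n) ≤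
        (R / (n - k) + (4 * η + 2 * ρ)) * (1 - k / T) := by
      have : 0 ≤ R / (n - k) := div_nonneg hR0 (by linarith)
      gcongr
    have h9 : 2 * η + ρ ≤ (4 * η + 2 * ρ) * (1 - k / n) := by nlinarith
    linarith

end EmpiricalTest

section LawOfLargeNumbers

variable {S : Type*} [MeasurableSpace S]

theorem measureReal_abs_sum_sub_le (P : Measure S) [IsProbabilityMeasure P] {φ : S → ℝ}
    (hφ : Measurable φ) (hφ01 : ∀ z, φ z ∈ Set.Icc (0 : ℝ) 1) {ε : ℝ} (hε : 0 < ε) {n : ℕ}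
    (hn : 0 < n) :
    (Measure.pi fun _ : Fin n => P).real {ω | n * ε ≤ |∑ i, φ (ω i) - n * ∫ z, φ z ∂P|} ≤
      1 / ε ^ 2 * (n : ℝ)⁻¹ := by
  have hn' : (0 : ℝ) < n := by exact_mod_cast hn
  have hmem : MemLp φ 2 P := MemLp.of_bound hφ.aestronglyMeasurable 1 (ae_of_all _ fun z => by
    rw [Real.norm_of_nonneg (hφ01 z).1]
    exact (hφ01 z).2)
  have hmemi : ∀ i : Fin n, MemLp (fun ω : Fin n → S => φ (ω i)) 2 (Measure.pi fun _ => P) :=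
    fun i => hmem.comp_measurePreserving (measurePreserving_eval _ i)
  have hmean : ∫ ω, (∑ i, fun ω : Fin n → S => φ (ω i)) ω ∂(Measure.pi fun _ => P) =
      n * ∫ z, φ z ∂P := by
    simp only [Finset.sum_apply]
    rw [integral_finsetSum _ fun i _ => (hmemi i).integrable (by norm_num)]
    simp [integral_comp_eval (μ := fun _ : Fin n => P) hφ.aestronglyMeasurable]
  have hvar : Var[∑ i, fun ω : Fin n → S => φ (ω i); Measure.pi fun _ => P] ≤ n := by
    rw [variance_sum_pi (X := fun _ : Fin n => φ) fun _ => hmem]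
    have h := variance_le_sq_of_bounded (μ := P) (ae_of_all _ hφ01) hφ.aemeasurable
    simp only [Finset.sum_const, Finset.card_univ, Fintype.card_fin, nsmul_eq_mul]
    nlinarith
  have h := meas_ge_le_variance_div_sq (memLp_finsetSum' _ fun i (_ : i ∈ Finset.univ) => hmemi i)
    (mul_pos hn' hε)
  rw [hmean] at h
  simp only [Finset.sum_apply] at h
  refine (ENNReal.toReal_le_of_le_ofReal
    (div_nonneg (variance_nonneg _ _) (by positivity)) h).trans ?_
  have h1 : 1 / ε ^ 2 * (n : ℝ)⁻¹ = n / (n * ε) ^ 2 := by field_simp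
  rw [h1]
  gcongr

theorem tendsto_measureReal_abs_sum_sub (P : Measure S) [IsProbabilityMeasure P] {φ : S → ℝ}
    (hφ : Measurable φ) (hφ01 : ∀ z, φ z ∈ Set.Icc (0 : ℝ) 1) {ε : ℝ} (hε : 0 < ε) :
    Tendsto (fun n : ℕ => (Measure.pi fun _ : Fin n => P).real
      {ω | n * ε ≤ |∑ i, φ (ω i) - n * ∫ z, φ z ∂P|}) atTop (nhds 0) := by
  refine squeeze_zero' (Eventually.of_forall fun _ => measureReal_nonneg)
    ((eventually_gt_atTop 0).mono fun n hn => measureReal_abs_sum_sub_le P hφ hφ01 hε hn) ?_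
  simpa only [mul_zero] using (tendsto_inv_atTop_nhds_zero_nat (𝕜 := ℝ)).const_mul (1 / ε ^ 2)

theorem tendsto_measureReal_sum_lt (P : Measure S) [IsProbabilityMeasure P] {φ : S → ℝ}
    (hφ : Measurable φ) (hφ01 : ∀ z, φ z ∈ Set.Icc (0 : ℝ) 1) {ε : ℝ} (hε : 0 < ε) :
    Tendsto (fun n : ℕ => (Measure.pi fun _ : Fin n => P).real
      {ω | (∑ i, φ (ω i)) / n + ε < ∫ z, φ z ∂P}) atTop (nhds 0) := by
  refine squeeze_zero' (Eventually.of_forall fun _ => measureReal_nonneg)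
    ((eventually_gt_atTop 0).mono fun n hn => ?_) (tendsto_measureReal_abs_sum_sub P hφ hφ01 hε)
  refine measureReal_mono fun ω hω => ?_
  have hn' : (0 : ℝ) < n := by exact_mod_cast hn
  simp only [Set.mem_ofPred_eq] at hω ⊢
  rw [← lt_sub_iff_add_lt, div_lt_iff₀ hn'] at hω
  rw [abs_sub_comm]
  exact le_trans (by linarith) (le_abs_self _)

theorem tendsto_measureReal_lt_sum (P : Measure S) [IsProbabilityMeasure P] {φ : S → ℝ}
    (hφ : Measurable φ) (hφ01 : ∀ z, φ z ∈ Set.Icc (0 : ℝ) 1) {η : ℝ} (hη : 0 < η) :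
    Tendsto (fun n : ℕ => (Measure.pi fun _ : Fin n => P).real
      {ω | (1 + η) * n * ∫ z, φ z ∂P < ∑ i, φ (ω i)}) atTop (nhds 0) := by
  rcases (integral_nonneg fun z => (hφ01 z).1 : 0 ≤ ∫ z, φ z ∂P).eq_or_lt with h0 | hpos
  · have hae : φ =ᵐ[P] 0 := (integral_eq_zero_iff_of_nonneg (fun z => (hφ01 z).1)
      (Integrable.of_bound hφ.aestronglyMeasurable 1 (ae_of_all _ fun z => by
        rw [Real.norm_of_nonneg (hφ01 z).1]
        exact (hφ01 z).2))).1 h0.symm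
    have hz : ∀ n : ℕ, (Measure.pi fun _ : Fin n => P).real
        {ω | (1 + η) * n * ∫ z, φ z ∂P < ∑ i, φ (ω i)} = 0 := by
      intro n
      have h : ∀ᵐ ω ∂(Measure.pi fun _ : Fin n => P), ∀ i, φ (ω i) = 0 := ae_all_iff.2 fun i =>
        (measurePreserving_eval (fun _ : Fin n => P) i).quasiMeasurePreserving.ae hae
      refine (measureReal_eq_zero_iff).2
        (measure_eq_zero_iff_ae_notMem.2 (h.mono fun ω hω hω' => ?_))
      simp [← h0, hω] at hω'
    simp [hz]
  · refine squeeze_zero (fun _ => measureReal_nonneg) (fun n => ?_)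
      (tendsto_measureReal_abs_sum_sub P hφ hφ01 (mul_pos hη hpos))
    refine measureReal_mono fun ω hω => ?_
    simp only [Set.mem_ofPred_eq] at hω ⊢
    refine le_trans ?_ (le_abs_self _)
    linarith

end LawOfLargeNumbers

section LowerBound

variable {𝒳 : Type*} [MeasurableSpace 𝒳]

theorem IsPosterior.exists_bin {P : Measure (Bool × 𝒳)} [IsProbabilityMeasure P]
    {W : Bool → 𝒳 → ℝ} (hW : IsPosterior P W) {ρ : ℝ} (hρ : 0 < ρ) :
    ∃ (K : ℕ) (bin : 𝒳 → Fin K), Measurable bin ∧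
      ∀ b x y, bin x = bin y → |W b x - W b y| ≤ ρ := by
  obtain ⟨k, hk⟩ := exists_nat_one_div_lt hρ
  have hfloor : ∀ x, ⌊(k + 1 : ℝ) * W true x⌋₊ < k + 2 := by
    intro x
    rw [Nat.floor_lt (mul_nonneg (by positivity) (hW.nonneg _ _))]
    push_cast
    nlinarith [hW.le_one true x]
  have hk0 : (0 : ℝ) < k + 1 := by positivity
  have htrue : ∀ x y, ⌊(k + 1 : ℝ) * W true x⌋₊ = ⌊(k + 1 : ℝ) * W true y⌋₊ →
      |W true x - W true y| ≤ ρ := by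
    intro x y h
    have h1 := Nat.floor_le (mul_nonneg hk0.le (hW.nonneg true x))
    have h2 := Nat.floor_le (mul_nonneg hk0.le (hW.nonneg true y))
    have h3 := Nat.lt_floor_add_one ((k + 1 : ℝ) * W true x)
    have h4 := Nat.lt_floor_add_one ((k + 1 : ℝ) * W true y)
    rw [h] at h1 h3
    refine le_trans ?_ hk.le
    rw [le_div_iff₀ hk0, ← abs_of_pos hk0, ← abs_mul, abs_le]
    constructor <;> linarith
  refine ⟨k + 2, fun x => Fin.ofNat (k + 2) ⌊(k + 1 : ℝ) * W true x⌋₊,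
    (measurable_of_countable (Fin.ofNat (k + 2))).comp
      (((hW.meas true).const_mul _).nat_floor), fun b x y h => ?_⟩
  have h' := congrArg Fin.val h
  simp only [Fin.val_ofNat, Nat.mod_eq_of_lt (hfloor _)] at h'
  cases b
  · have hx := hW.sum_one true x
    have hy := hW.sum_one true y
    simp only [Bool.not_true] at hx hy
    have : W false x - W false y = -(W true x - W true y) := by linarith
    rw [this, abs_neg]
    exact htrue x y h'
  · exact htrue x y h'

theorem IsPosterior.tendsto_measureReal_atypical {P : Measure (Bool × 𝒳)} [IsProbabilityMeasure P]
    {W : Bool → 𝒳 → ℝ} (hW : IsPosterior P W) {K : ℕ} {bin : 𝒳 → Fin K} (hbin : Measurable bin)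
    {η : ℝ} (hη : 0 < η) :
    Tendsto (fun n : ℕ => (Measure.pi fun _ : Fin n => P).real {ω | ¬((∀ j,
      ∑ i, binIndicator bin j (ω i).2 ≤ (1 + η) * n * ∫ z, binIndicator bin j z.2 ∂P) ∧
      ∀ b, ∫ z, W b z.2 ∂P ≤ (∑ i, W b (ω i).2) / n + η)}) atTop (nhds 0) := by
  have h1 := fun j => tendsto_measureReal_lt_sum P
    ((measurable_binIndicator hbin j).comp measurable_snd)
    (fun z : Bool × 𝒳 => ⟨binIndicator_nonneg bin j z.2, binIndicator_le_one bin j z.2⟩) hη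
  have h2 := fun b => tendsto_measureReal_sum_lt P ((hW.meas b).comp measurable_snd)
    (fun z : Bool × 𝒳 => ⟨hW.nonneg b z.2, hW.le_one b z.2⟩) hη
  have h := (tendsto_finsetSum Finset.univ fun j _ => h1 j).add
    (tendsto_finsetSum Finset.univ fun b _ => h2 b)
  simp only [Finset.sum_const_zero, add_zero] at h
  refine squeeze_zero (fun _ => measureReal_nonneg) (fun n => ?_) h
  refine le_trans (measureReal_mono ?_) ((measureReal_union_le _ _).trans (add_le_add
    (measureReal_iUnion_fintype_le _) (measureReal_iUnion_fintype_le _)))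
  intro ω hω
  simp only [Set.mem_ofPred_eq, not_and_or, not_forall, not_le] at hω
  simpa using hω

theorem IsPosterior.eventually_le_sum_risk {P : Measure (Bool × 𝒳)} [IsProbabilityMeasure P]
    {W : Bool → 𝒳 → ℝ} (hW : IsPosterior P W) {m : Bool → ℝ} (hm : ∀ b, 0 ≤ m b) {c : ℝ}
    (hc : ∀ q, IsTest q → c ≤ ∑ b, m b * rate P b q) {ε : ℝ} (hε : 0 < ε) :
    ∀ᶠ n : ℕ in atTop, ∀ κ : (Fin n → 𝒳) → Measure (Fin n → Bool), IsRule κ →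
      c - ε ≤ ∑ b, m b * risk P b κ := by
  set B : ℝ := ∑ b, m b + 1 with hB
  have hm0 : 0 ≤ ∑ b, m b := Finset.sum_nonneg fun b _ => hm b
  have hB0 : 0 < B := by positivity
  set η : ℝ := ε / (16 * B) with hη
  have hη0 : 0 < η := by positivity
  obtain ⟨K, bin, hbin, hclose⟩ := hW.exists_bin (ρ := 2 * η) (by positivity)
  have hslack : (∑ b, m b) * (4 * η + 2 * (2 * η)) ≤ ε / 2 := by
    have h1 : B * (4 * η + 2 * (2 * η)) = ε / 2 := by
      rw [hη]
      field_simp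
      norm_num
    rw [← h1]
    gcongr
    linarith
  have hlim := (hW.tendsto_measureReal_atypical hbin hη0).const_mul |c|
  rw [mul_zero] at hlim
  filter_upwards [hlim.eventually_le_const (half_pos hε), eventually_gt_atTop 0] with n hbad hn κ hκ
  set A : Set (Fin n → Bool × 𝒳) := {ω | ¬((∀ j,
    ∑ i, binIndicator bin j (ω i).2 ≤ (1 + η) * n * ∫ z, binIndicator bin j z.2 ∂P) ∧
    ∀ b, ∫ z, W b z.2 ∂P ≤ (∑ i, W b (ω i).2) / n + η)} with hA
  set μ : Measure (Fin n → Bool × 𝒳) := Measure.pi fun _ => P with hμ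
  set V : Bool → (Fin n → 𝒳) → (Fin n → Bool) → ℝ :=
    fun b x d => ∑ i, W b (x i) * weight b d i with hV
  have hV0 : ∀ b x d, 0 ≤ V b x d := fun b x d => Finset.sum_nonneg fun i _ =>
    mul_nonneg (hW.nonneg _ _) (weight_nonneg _ _ _)
  have hV1 : ∀ b x d, V b x d ≤ 1 := fun b x d => (Finset.sum_le_sum fun i _ =>
    mul_le_of_le_one_left (weight_nonneg b d i) (hW.le_one b (x i))).trans (sum_weight_le_one b d)
  have hVint : ∀ b, Integrable (fun ω : Fin n → Bool × 𝒳 =>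
      ∫ d, V b (fun i => (ω i).2) d ∂(κ fun i => (ω i).2)) μ := by
    intro b
    refine integrable_of_bound ?_ 1 fun ω => ?_
    · simp_rw [hκ.integral_eq]
      refine Finset.measurable_sum _ fun d _ =>
        ((hκ.measurable_real d).comp measurable_snd_pi).mul ?_
      exact Finset.measurable_sum _ fun i _ => ((hW.meas b).comp
        (measurable_snd.comp (measurable_pi_apply i))).mul_const _
    · have := hκ.2 fun i => (ω i).2
      rw [abs_of_nonneg (integral_nonneg fun d => hV0 _ _ _)]
      refine (integral_mono (Integrable.of_finite) (integrable_const 1) fun d => hV1 _ _ _).trans ?_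
      simp
  have hpt : ∀ ω : Fin n → Bool × 𝒳, c - ε / 2 - (toMeasurable μ A).indicator (fun _ => |c|) ω ≤
      ∑ b, m b * ∫ d, V b (fun i => (ω i).2) d ∂(κ fun i => (ω i).2) := by
    intro ω
    have hprob := hκ.2 fun i => (ω i).2
    by_cases hω : ω ∈ A
    · rw [Set.indicator_of_mem (subset_toMeasurable μ A hω)]
      refine le_trans ?_ (Finset.sum_nonneg fun b _ => mul_nonneg (hm b)
        (integral_nonneg fun d => hV0 _ _ _))
      linarith [le_abs_self c]
    · obtain ⟨hN, hE⟩ := not_not.1 hω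
      have hd : ∀ d, c - ε / 2 ≤ ∑ b, m b * V b (fun i => (ω i).2) d := by
        intro d
        obtain ⟨q, hq, hqV⟩ := hW.exists_test hbin (by positivity) hη0.le hclose hn
          (fun i => (ω i).2) hN hE d
        have h1 := (hc q hq).trans (Finset.sum_le_sum fun b _ =>
          mul_le_mul_of_nonneg_left (hqV b) (hm b))
        simp only [mul_add, Finset.sum_add_distrib, ← Finset.sum_mul] at h1 hslack
        change c ≤ ∑ b, m b * V b (fun i => (ω i).2) d + _ at h1
        linarith
      have h2 : c - ε / 2 ≤ ∑ b, m b * ∫ d, V b (fun i => (ω i).2) d ∂(κ fun i => (ω i).2) := by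
        have h3 := integral_mono (μ := κ fun i => (ω i).2) (integrable_const (c - ε / 2))
          Integrable.of_finite hd
        rw [integral_finsetSum _ fun _ _ => Integrable.of_finite] at h3
        simpa [integral_const_mul] using h3
      have h3 : 0 ≤ (toMeasurable μ A).indicator (fun _ => |c|) ω :=
        Set.indicator_nonneg (fun _ _ => abs_nonneg c) ω
      linarith
  have hind : Integrable ((toMeasurable μ A).indicator fun _ => |c|) μ :=
    (integrable_const _).indicator (measurableSet_toMeasurable μ A)
  have hfin := integral_mono ((integrable_const (c - ε / 2)).sub hind)
    (integrable_finsetSum _ fun b _ => (hVint b).const_mul (m b)) hpt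
  rw [integral_finsetSum _ fun b _ => (hVint b).const_mul (m b)] at hfin
  simp only [integral_const_mul] at hfin
  have hl : ∫ ω, (c - ε / 2 - (toMeasurable μ A).indicator (fun _ => |c|) ω) ∂μ =
      c - ε / 2 - |c| * μ.real A := by
    rw [integral_sub (integrable_const _) hind,
      integral_indicator_const _ (measurableSet_toMeasurable μ A)]
    simp [measureReal_def, measure_toMeasurable, mul_comm]
  have hr : ∀ b, risk P b κ = ∫ ω, ∫ d, V b (fun i => (ω i).2) d ∂(κ fun i => (ω i).2) ∂μ :=
    fun b => hW.risk_eq b hκ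
  simp only [hr]
  simp only [Pi.sub_apply] at hfin
  rw [hl] at hfin
  linarith

end LowerBound

namespace Model

variable {𝒳 : Type*} [MeasurableSpace 𝒳] (M : Model 𝒳)

theorem eventually_lt_FNRstar {m c α : ℝ} (hm : 0 ≤ m) (hα : 0 ≤ α)
    (hc : ∀ q, IsTest q → c ≤ m * rate M.joint true q + rate M.joint false q) {a : ℝ}
    (ha : a < c - m * α) : ∀ᶠ n : ℕ in atTop, a < M.FNRstar n α := by
  have := M.isProbabilityMeasure_joint
  have hmb : ∀ b : Bool, 0 ≤ if b then m else 1 := fun b => by cases b <;> simp [hm]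
  have hev := M.isPosterior_post.eventually_le_sum_risk (m := fun b => if b then m else 1) hmb
    (c := c) (by simpa using hc) (half_pos (sub_pos.2 ha))
  filter_upwards [hev] with n hn
  have hle : c - m * α - (c - m * α - a) / 2 ≤ M.FNRstar n α := by
    refine le_csInf (M.nonempty_FNR n hα) ?_
    rintro _ ⟨κ, hκ, hFDR, rfl⟩
    have h := hn κ hκ
    rw [FDR_eq_risk] at hFDR
    rw [FNR_eq_risk]
    simp only [Fintype.sum_bool, if_true, Bool.false_eq_true, if_false, one_mul] at h
    linarith [mul_le_mul_of_nonneg_left hFDR hm]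
  linarith

theorem exists_slope_mFNRstar_zero {ε : ℝ} (hε : 0 < ε) :
    ∃ m : ℝ, 0 ≤ m ∧ ∀ q, IsTest q →
      M.mFNRstar 0 - ε ≤ m * rate M.joint true q + rate M.joint false q := by
  have := M.isProbabilityMeasure_joint
  have hW := M.isPosterior_post
  set P := M.joint
  set W := M.post
  set h := M.mFNRstar 0 with hh
  have hh0 : 0 ≤ h := M.mFNRstar_nonneg le_rfl
  have hh1 : h ≤ 1 := (M.mFNRstar_le_rate (isTest_constTest false)
    (rate_constTest M.joint true).le).trans ((isTest_constTest false).rate_le_one _ _)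
  have h_int : ∀ {g : 𝒳 → ℝ}, Measurable g → (∀ x, 0 ≤ g x) → (∀ x, g x ≤ 1) →
      Integrable (fun z : Bool × 𝒳 => g z.2) P := fun hg h0 h1 =>
    integrable_of_bound (hg.comp measurable_snd) 1 fun z => by
      rw [abs_of_nonneg (h0 _)]
      exact h1 _
  set I : 𝒳 → ℝ := fun x => if 0 < W true x then 1 else 0 with hI
  have hpos : MeasurableSet {x | 0 < W true x} := measurableSet_lt measurable_const (hW.meas true)
  have hIm : Measurable I := Measurable.ite hpos measurable_const measurable_const
  have hI0 : ∀ x, 0 ≤ I x := fun x => by simp only [hI]; split_ifs <;> simp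
  have hI1 : ∀ x, I x ≤ 1 := fun x => by simp only [hI]; split_ifs <;> simp
  have hWI : ∀ x, W true x ≤ I x := fun x => by
    simp only [hI]
    split_ifs with hx
    · exact hW.le_one _ _
    · exact not_lt.1 hx
  have hIi := h_int hIm hI0 hI1
  have hWqi : ∀ {q}, IsTest q → ∀ b, Integrable (fun z : Bool × 𝒳 => W b z.2 * q b z.2) P :=
    fun {q} hq b => h_int (g := fun x => W b x * q b x) ((hW.meas b).mul (hq.meas b))
      (fun x => mul_nonneg (hW.nonneg b x) (hq.nonneg b x))
      fun x => mul_le_one₀ (hW.le_one b x) (hq.nonneg b x) (hq.le_one b x)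
  have hqi : ∀ {q}, IsTest q → ∀ b, Integrable (fun z : Bool × 𝒳 => q b z.2) P :=
    fun {q} hq b => h_int (hq.meas b) (hq.nonneg b) (hq.le_one b)
  set p : ℝ := ∫ z, I z.2 ∂P with hp
  have hp0 : 0 ≤ p := integral_nonneg fun z => hI0 _
  rcases hp0.eq_or_lt with hp0 | hp0
  · refine ⟨0, le_rfl, fun q hq => ?_⟩
    have hle : ∫ z, W true z.2 * q true z.2 ∂P ≤ 0 := by
      rw [hp0]
      exact integral_mono (hWqi hq true) hIi fun z =>
        (mul_le_of_le_one_right (hW.nonneg _ _) (hq.le_one _ _)).trans (hWI _)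
    have h1 := M.mFNRstar_le_rate hq (α := 0) (by
      rw [hq.rate_eq hW]
      exact div_nonpos_of_nonpos_of_nonneg hle (hq.integral_nonneg P true))
    linarith
  set δ : ℝ := p * ε / (1 + ε) with hδ
  have hδ0 : 0 < δ := by positivity
  have hlim : Tendsto (fun k : ℕ => ∫ z, I z.2 * max 0 (1 - k * W true z.2) ∂P) atTop (nhds 0) := by
    have hmax : ∀ (k : ℕ) x, max 0 (1 - k * W true x) ≤ 1 := fun k x => max_le zero_le_one
      (sub_le_self _ (mul_nonneg k.cast_nonneg (hW.nonneg _ _)))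
    have hlim0 := tendsto_integral_of_dominated_convergence (μ := P) (f := fun _ => (0 : ℝ))
      (F := fun (k : ℕ) z => I z.2 * max 0 (1 - k * W true z.2)) (fun _ => 1)
      (fun k => ((hIm.mul (measurable_const.max (((hW.meas true).const_mul _).const_sub 1))).comp
        measurable_snd).aestronglyMeasurable) (integrable_const 1)
      (fun k => ae_of_all _ fun z => by
        rw [Real.norm_of_nonneg (mul_nonneg (hI0 _) (le_max_left _ _))]
        exact mul_le_one₀ (hI1 _) (le_max_left _ _) (hmax _ _))
      (ae_of_all _ fun z => by
        refine tendsto_const_nhds.congr' ?_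
        by_cases hz : 0 < W true z.2
        · obtain ⟨N, hN⟩ := exists_nat_gt (1 / W true z.2)
          filter_upwards [eventually_ge_atTop N] with k hk
          have hk' : (N : ℝ) ≤ k := by exact_mod_cast hk
          rw [div_lt_iff₀ hz] at hN
          rw [max_eq_left (by nlinarith), mul_zero]
        · simp [hI, hz])
    simpa using hlim0
  obtain ⟨k, hk⟩ := (hlim.eventually_le_const (half_pos hδ0)).exists
  set m : ℝ := 2 * k / δ + 1 with hm
  have hm0 : 0 < m := by positivity
  refine ⟨m, hm0.le, fun q hq => ?_⟩
  have hr0 := hq.rate_nonneg P true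
  have hr0' := hq.rate_nonneg P false
  by_cases hr : h ≤ m * rate P true q
  · linarith
  have hr1 : m * rate P true q ≤ 1 := by linarith
  have hWq : m * ∫ z, W true z.2 * q true z.2 ∂P ≤ 1 := by
    have h1 := hq.integral_loss_eq P true
    have h2 := hW.integral_eq true (q true) (hq.meas true) (hq.abs_le_one true)
    change ∫ z, loss true z.1 * q true z.2 ∂P = _ at h2
    rw [← h2, h1, ← mul_assoc]
    refine mul_le_one₀ hr1 (hq.integral_nonneg P true) ?_
    simpa using integral_mono (hqi hq true) (integrable_const 1) fun z => hq.le_one true z.2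
  have hqIi : Integrable (fun z : Bool × 𝒳 => q true z.2 * I z.2) P :=
    h_int (g := fun x => q true x * I x) ((hq.meas true).mul hIm)
      (fun x => mul_nonneg (hq.nonneg _ _) (hI0 _))
      fun x => mul_le_one₀ (hq.le_one _ _) (hI0 _) (hI1 _)
  set J : ℝ := ∫ z, q true z.2 * I z.2 ∂P with hJ
  have hJδ : J ≤ δ := by
    have hmi : Integrable (fun z : Bool × 𝒳 => I z.2 * max 0 (1 - k * W true z.2)) P :=
      h_int (g := fun x => I x * max 0 (1 - k * W true x))
        (hIm.mul (measurable_const.max (((hW.meas true).const_mul _).const_sub 1)))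
        (fun x => mul_nonneg (hI0 _) (le_max_left _ _))
        fun x => mul_le_one₀ (hI1 _) (le_max_left _ _) (max_le zero_le_one
          (sub_le_self _ (mul_nonneg k.cast_nonneg (hW.nonneg _ _))))
    have h1 : J ≤ ∫ z, (k * (W true z.2 * q true z.2) +
        I z.2 * max 0 (1 - k * W true z.2)) ∂P := by
      refine integral_mono hqIi (((hWqi hq true).const_mul _).add hmi) fun z => ?_
      have h2 := hq.nonneg true z.2
      have h3 := hq.le_one true z.2
      have h4 := le_max_left 0 (1 - k * W true z.2)
      have h5 := le_max_right 0 (1 - k * W true z.2)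
      have h6 : 0 ≤ k * (W true z.2 * q true z.2) :=
        mul_nonneg k.cast_nonneg (mul_nonneg (hW.nonneg _ _) h2)
      simp only [hI]
      split_ifs
      · nlinarith
      · linarith
    rw [integral_add ((hWqi hq true).const_mul _) hmi, integral_const_mul] at h1
    have h2 : k * ∫ z, W true z.2 * q true z.2 ∂P ≤ δ / 2 := by
      have h3 : 2 * k / δ * ∫ z, W true z.2 * q true z.2 ∂P ≤ 1 := by
        have : 0 ≤ ∫ z, W true z.2 * q true z.2 ∂P := integral_nonneg fun z =>
          mul_nonneg (hW.nonneg true z.2) (hq.nonneg true z.2)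
        refine le_trans ?_ hWq
        gcongr
        linarith
      rw [div_mul_eq_mul_div, div_le_one hδ0] at h3
      linarith
    linarith
  set q' : Bool → 𝒳 → ℝ := fun b x =>
    if b then q true x * (1 - I x) else q false x + q true x * I x with hq'
  have hqt : ∀ x, q true x + q false x = 1 := fun x => hq.sum_one true x
  have hq't : IsTest q' := by
    refine ⟨fun b => ?_, fun b x => ?_, fun b x => ?_⟩
    · cases b
      · exact (hq.meas false).add ((hq.meas true).mul hIm)
      · exact (hq.meas true).mul (hIm.const_sub 1)
    · cases b
      · simpa [hq'] using add_nonneg (hq.nonneg false x) (mul_nonneg (hq.nonneg true x) (hI0 x))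
      · simpa [hq'] using mul_nonneg (hq.nonneg true x) (sub_nonneg.2 (hI1 x))
    · have := hqt x
      cases b <;> simp only [hq', Bool.not_true, Bool.not_false, if_true, Bool.false_eq_true,
        if_false] <;> linarith
  have hrate' : rate P true q' = 0 := by
    have hz : ∀ x, W true x * q' true x = 0 := by
      intro x
      simp only [hq', hI, if_true]
      split_ifs with hx
      · simp
      · simp [le_antisymm (not_lt.1 hx) (hW.nonneg true x)]
    rw [hq't.rate_eq hW]
    simp [hz]
  have hle := M.mFNRstar_le_rate hq't hrate'.le
  rw [hq't.rate_eq hW] at hle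
  set D : ℝ := ∫ z, q false z.2 ∂P with hD
  set N : ℝ := ∫ z, W false z.2 * q false z.2 ∂P with hN
  have hD' : ∫ z, q' false z.2 ∂P = D + J := by
    rw [hD, hJ, ← integral_add (hqi hq false) hqIi]
    simp [hq']
  have hN' : ∫ z, W false z.2 * q' false z.2 ∂P ≤ N + J := by
    rw [hN, hJ, ← integral_add (hWqi hq false) hqIi]
    refine integral_mono (hWqi hq't false) ((hWqi hq false).add hqIi) fun z => ?_
    have h1 := mul_nonneg (hq.nonneg true z.2) (hI0 z.2)
    have h2 := hW.le_one false z.2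
    simp only [hq', Bool.false_eq_true, if_false]
    nlinarith
  have hDp : p - J ≤ D := by
    rw [hp, hJ, hD, ← integral_sub hIi hqIi]
    refine integral_mono (hIi.sub hqIi) (hqi hq false) fun z => ?_
    have h1 := hqt z.2
    have h2 := hq.nonneg false z.2
    have h3 := hI0 z.2
    have h4 := hI1 z.2
    change I z.2 - q true z.2 * I z.2 ≤ q false z.2
    nlinarith
  have hJ0 : 0 ≤ J := integral_nonneg fun z => mul_nonneg (hq.nonneg _ _) (hI0 _)
  have hpδ : p - δ = p / (1 + ε) := by
    rw [hδ]
    field_simp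
    ring
  have hεδ : ε * (p - δ) = δ := by
    rw [hpδ, hδ]
    ring
  have hpδ0 : 0 < p - δ := by
    rw [hpδ]
    positivity
  have hDpos : 0 < D := by linarith
  rw [hD', le_div_iff₀ (by linarith)] at hle
  have hgoal : h - ε ≤ rate P false q := by
    rw [hq.rate_eq hW, le_div_iff₀ hDpos]
    have h1 : δ ≤ ε * D := by
      rw [← hεδ]
      gcongr
      linarith
    nlinarith [mul_nonneg hh0 hJ0]
  nlinarith

end Model

theorem exists_affine_le_of_convexOn {s : Set ℝ} {C : ℝ → ℝ} (hC : ConvexOn ℝ s C) {α : ℝ}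
    (hα : α ∈ interior s) : ∃ m, ∀ t ∈ s, C α + m * (t - α) ≤ C t := by
  refine ⟨derivWithin C (Set.Ioi α) α, fun t ht => ?_⟩
  rcases lt_trichotomy t α with h | rfl | h
  · have h1 := (hC.slope_le_leftDeriv_of_mem_interior ht hα h).trans
      (hC.leftDeriv_le_rightDeriv_of_mem_interior hα)
    rw [slope_def_field, div_le_iff₀ (sub_pos.2 h)] at h1
    linarith
  · simp
  · have h1 := hC.rightDeriv_le_slope_of_mem_interior hα ht h
    rw [slope_def_field, le_div_iff₀ (sub_pos.2 h)] at h1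
    linarith

namespace Model

variable {𝒳 : Type*} [MeasurableSpace 𝒳] (M : Model 𝒳)

theorem eventually_lt_FNRstar_of_convexOn {C : ℝ → ℝ} (hC : ConvexOn ℝ (Set.Icc 0 1) C)
    (hCle : ∀ t ∈ Set.Icc (0 : ℝ) 1, C t ≤ M.mFNRstar t) {α a : ℝ} (hα : α ∈ Set.Icc (0 : ℝ) 1)
    (ha : a < C α) : ∀ᶠ n : ℕ in atTop, a < M.FNRstar n α := by
  have := M.isProbabilityMeasure_joint
  rcases lt_or_ge a 0 with ha0 | ha0
  · exact Eventually.of_forall fun n => ha0.trans_le (M.FNRstar_nonneg n α)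
  have hC1 : C 1 ≤ 0 := (hCle 1 (by simp)).trans_eq M.mFNRstar_one
  rcases hα.1.eq_or_lt with rfl | hα0
  · obtain ⟨m, hm, h⟩ := M.exists_slope_mFNRstar_zero (half_pos (sub_pos.2 ha))
    refine M.eventually_lt_FNRstar hm le_rfl h ?_
    linarith [hCle 0 hα]
  rcases hα.2.eq_or_lt with rfl | hα1
  · linarith
  obtain ⟨s, hs⟩ := exists_affine_le_of_convexOn hC (α := α) (by simpa using ⟨hα0, hα1⟩)
  have hs0 : s ≤ 0 := by
    by_contra! hs0
    nlinarith [hs 1 (by simp)]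
  refine M.eventually_lt_FNRstar (m := -s) (c := C α + -s * α) (by linarith) hα0.le
    (fun q hq => ?_) (by linarith)
  have ht : rate M.joint true q ∈ Set.Icc (0 : ℝ) 1 :=
    ⟨hq.rate_nonneg _ _, hq.rate_le_one _ _⟩
  linarith [hs _ ht, hCle _ ht, M.mFNRstar_le_rate hq le_rfl]

end Model

/-- **Asymptotically optimal FDR control** (Theorem 1, first part). For every FDR level
`α ∈ [0,1]`, the limit `FNR*(α) = lim_n FNR*_n(α)` exists and, as a function of `α`,
equals the greatest convex minorant of `mFNR*` on `[0,1]`. -/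
theorem FNRstar_tendsto_gcm_mFNRstar {𝒳 : Type*} [MeasurableSpace 𝒳] (M : Model 𝒳) :
    ∀ α ∈ Set.Icc (0 : ℝ) 1,
      Filter.Tendsto (fun n => M.FNRstar n α) Filter.atTop (nhds (gcm M.mFNRstar α)) := by
  refine fun α hα => tendsto_order.2 ⟨fun a ha => ?_, fun a ha => ?_⟩
  · have hne : {y | ∃ C : ℝ → ℝ, ConvexOn ℝ (Set.Icc 0 1) C ∧
        (∀ t ∈ Set.Icc (0 : ℝ) 1, C t ≤ M.mFNRstar t) ∧ y = C α}.Nonempty :=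
      ⟨_, M.FNRstar 0, M.convexOn_FNRstar 0, fun t ht => M.FNRstar_le_mFNRstar 0 ht.1, rfl⟩
    obtain ⟨_, ⟨C, hC, hCle, rfl⟩, haC⟩ := exists_lt_of_lt_csSup hne ha
    exact M.eventually_lt_FNRstar_of_convexOn hC hCle hα haC
  · exact Eventually.of_forall fun n => (M.FNRstar_le_gcm n hα).trans_lt ha

end TwoGroup
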